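/- arXiv:2103.07848 — 3 statements merged into one kernel-verified Lean document; each statement's English description precedes it below -/
import Mathlib

section
/- Let Ω ⊂ ℝ^d be a convex domain and let δ ∈ [0,1). Then ‖d_Γ^{δ/2−1}φ‖_2 ≤ (2/(1−δ)) ‖d_Γ^{δ/2}|∇φ|‖_2 for all φ ∈ C_c^1(Ω); in particular the weighted Hardy inequality holds on all of Ω with constant 2/(1−δ). -/
open MeasureTheory Metric Set ENNReal RealInnerProductSpace

noncomputable section

/-- The Euclidean distance from `x` to the boundary `Γ = ∂Ω` of `Ω`. -/
def distB {d : ℕ} (Ω : Set (EuclideanSpace ℝ (Fin d))) (x : EuclideanSpace ℝ (Fin d)) : ℝ :=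
  Metric.infDist x (frontier Ω)

/-- The boundary layer `Γ_r = {x ∈ Ω : d_Γ(x) < r}`. -/
def bdryLayer {d : ℕ} (Ω : Set (EuclideanSpace ℝ (Fin d))) (r : ℝ) :
    Set (EuclideanSpace ℝ (Fin d)) :=
  {x | x ∈ Ω ∧ distB Ω x < r}

/-- `C_c^1` real functions with compact support contained in `U`. -/
def IsCc1 {d : ℕ} (U : Set (EuclideanSpace ℝ (Fin d)))
    (ψ : EuclideanSpace ℝ (Fin d) → ℝ) : Prop :=
  ContDiff ℝ 1 ψ ∧ HasCompactSupport ψ ∧ tsupport ψ ⊆ U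

/-- The `L²` norm with respect to Lebesgue measure. -/
def L2N {d : ℕ} (f : EuclideanSpace ℝ (Fin d) → ℝ) : ℝ≥0∞ :=
  eLpNorm f 2 volume

/-- The weighted norm `‖d_Γ^p ψ‖₂`. -/
def wNorm {d : ℕ} (Ω : Set (EuclideanSpace ℝ (Fin d))) (p : ℝ)
    (ψ : EuclideanSpace ℝ (Fin d) → ℝ) : ℝ≥0∞ :=
  L2N (fun x => distB Ω x ^ p * ψ x)

/-- The weighted gradient norm `‖d_Γ^p |∇ψ|‖₂`. -/
def wGradNorm {d : ℕ} (Ω : Set (EuclideanSpace ℝ (Fin d))) (p : ℝ)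
    (ψ : EuclideanSpace ℝ (Fin d) → ℝ) : ℝ≥0∞ :=
  L2N (fun x => distB Ω x ^ p * ‖fderiv ℝ ψ x‖)

/-- The (boundary) Hardy inequality `‖d_Γ^{δ/2-1}ψ‖₂ ≤ a ‖d_Γ^{δ/2}|∇ψ|‖₂`
with constant `a` for all test functions `ψ ∈ C_c^1(S)`. -/
def BHardy {d : ℕ} (Ω : Set (EuclideanSpace ℝ (Fin d))) (δ : ℝ)
    (S : Set (EuclideanSpace ℝ (Fin d))) (a : ℝ) : Prop :=
  ∀ ψ, IsCc1 S ψ → wNorm Ω (δ/2 - 1) ψ ≤ ENNReal.ofReal a * wGradNorm Ω (δ/2) ψ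

/-- The weak Hardy inequality `‖d_Γ^{δ/2-1}ψ‖₂ ≤ b ‖d_Γ^{δ/2}|∇ψ|‖₂ + c ‖ψ‖₂`
with constants `b, c` for all test functions `ψ ∈ C_c^1(S)`. -/
def WHardy {d : ℕ} (Ω : Set (EuclideanSpace ℝ (Fin d))) (δ : ℝ)
    (S : Set (EuclideanSpace ℝ (Fin d))) (b c : ℝ) : Prop :=
  ∀ ψ, IsCc1 S ψ →
    wNorm Ω (δ/2 - 1) ψ ≤ ENNReal.ofReal b * wGradNorm Ω (δ/2) ψ + ENNReal.ofReal c * L2N ψ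

/-- The optimal Hardy constant for test functions supported in `S`
(the infimum of the `a > 0` for which the Hardy inequality holds on `S`;
`∞` if there is no such constant). -/
def hardyConstS {d : ℕ} (Ω : Set (EuclideanSpace ℝ (Fin d))) (δ : ℝ)
    (S : Set (EuclideanSpace ℝ (Fin d))) : ℝ≥0∞ :=
  sInf {t | ∃ a : ℝ, 0 < a ∧ t = ENNReal.ofReal a ∧ BHardy Ω δ S a}

/-- The boundary Hardy constant `a_δ(Γ) = inf_{r>0} a_δ(Γ_r)`. -/
def hardyConst {d : ℕ} (Ω : Set (EuclideanSpace ℝ (Fin d))) (δ : ℝ) : ℝ≥0∞ :=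
  ⨅ (r : ℝ) (_ : 0 < r), hardyConstS Ω δ (bdryLayer Ω r)

/-- The local boundary Hardy constant `a_δ(Γ ∩ U) = inf_{r>0} a_δ(Γ_r ∩ U)`. -/
def hardyConstOn {d : ℕ} (Ω : Set (EuclideanSpace ℝ (Fin d))) (δ : ℝ)
    (U : Set (EuclideanSpace ℝ (Fin d))) : ℝ≥0∞ :=
  ⨅ (r : ℝ) (_ : 0 < r), hardyConstS Ω δ (bdryLayer Ω r ∩ U)

/-- The weak Hardy constant `b_δ(Ω)`: the infimum of the `b > 0` for which there
is a `c > 0` such that the weak Hardy inequality holds on `Ω`. -/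
def weakConstDomain {d : ℕ} (Ω : Set (EuclideanSpace ℝ (Fin d))) (δ : ℝ) : ℝ≥0∞ :=
  sInf {t | ∃ b c : ℝ, 0 < b ∧ 0 < c ∧ t = ENNReal.ofReal b ∧ WHardy Ω δ Ω b c}

/-- The weak Hardy constant `b_δ(Γ)`: the infimum of the `b > 0` for which there
are `r > 0` and `c > 0` such that the weak Hardy inequality holds on `Γ_r`. -/
def weakConstBdry {d : ℕ} (Ω : Set (EuclideanSpace ℝ (Fin d))) (δ : ℝ) : ℝ≥0∞ :=
  sInf {t | ∃ b c r : ℝ, 0 < b ∧ 0 < c ∧ 0 < r ∧ t = ENNReal.ofReal b ∧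
    WHardy Ω δ (bdryLayer Ω r) b c}

/-- The weak Hardy constant `b_δ(Γ ∩ U)`. -/
def weakConstOn {d : ℕ} (Ω : Set (EuclideanSpace ℝ (Fin d))) (δ : ℝ)
    (U : Set (EuclideanSpace ℝ (Fin d))) : ℝ≥0∞ :=
  sInf {t | ∃ b c r : ℝ, 0 < b ∧ 0 < c ∧ 0 < r ∧ t = ENNReal.ofReal b ∧
    WHardy Ω δ (bdryLayer Ω r ∩ U) b c}

/-- A domain: a nonempty open connected proper subset of `ℝ^d`. -/
def IsDomainSet {d : ℕ} (Ω : Set (EuclideanSpace ℝ (Fin d))) : Prop :=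
  IsOpen Ω ∧ IsConnected Ω ∧ Ω ≠ Set.univ

open Filter Topology
open scoped NNReal

/-- The distance from a point of `Ω` to the boundary is the distance to the complement. -/
theorem infDist_frontier_eq_infDist_compl {E : Type*} [NormedAddCommGroup E] [NormedSpace ℝ E]
    [FiniteDimensional ℝ E] {Ω : Set E} (ho : IsOpen Ω) (hne : Ω ≠ univ) {x : E} (hx : x ∈ Ω) :
    infDist x (frontier Ω) = infDist x Ωᶜ := by
  obtain ⟨y, hy, hxy⟩ := exists_mem_frontier_infDist_compl_eq_dist hx hne
  refine le_antisymm (hxy ▸ infDist_le_dist_of_mem hy) ?_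
  exact infDist_le_infDist_of_subset (by rw [ho.frontier_eq]; exact sdiff_subset_compl _ _) ⟨y, hy⟩

/-- The distance to the complement of a convex set is concave on that set. -/
theorem Convex.concaveOn_infDist_compl {E : Type*} [NormedAddCommGroup E] [NormedSpace ℝ E]
    {Ω : Set E} (hconv : Convex ℝ Ω) (hne : Ω ≠ univ) :
    ConcaveOn ℝ Ω (fun x ↦ infDist x Ωᶜ) := by
  refine ⟨hconv, fun x hx y hy a b ha hb hab ↦ ?_⟩
  refine (le_infDist (nonempty_compl.2 hne)).2 fun z hz ↦ ?_
  by_contra! hlt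
  simp only [smul_eq_mul] at hlt
  set R := a * infDist x Ωᶜ + b * infDist y Ωᶜ with hR
  have hRpos : 0 < R := dist_nonneg.trans_lt hlt
  set w := R⁻¹ • (z - (a • x + b • y)) with hw
  have hwn : ‖w‖ < 1 := by
    rw [hw, norm_smul, norm_inv, Real.norm_of_nonneg hRpos.le, ← dist_eq_norm, dist_comm,
      inv_mul_lt_one₀ hRpos]
    exact hlt
  have key : ∀ p ∈ Ω, p + infDist p Ωᶜ • w ∈ Ω := by
    intro p hp
    rcases (infDist_nonneg : 0 ≤ infDist p Ωᶜ).eq_or_lt with h0 | h0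
    · simpa [← h0] using hp
    · apply ball_infDist_compl_subset (x := p)
      rw [mem_ball, dist_eq_norm, add_sub_cancel_left, norm_smul, Real.norm_of_nonneg h0.le]
      exact mul_lt_of_lt_one_right h0 hwn
  refine hz ?_
  have hmem := hconv (key x hx) (key y hy) ha hb hab
  have : a • (x + infDist x Ωᶜ • w) + b • (y + infDist y Ωᶜ • w) = z := by
    have h1 : R • w = z - (a • x + b • y) := by
      rw [hw, smul_smul, mul_inv_cancel₀ hRpos.ne', one_smul]
    have h2 : a • (x + infDist x Ωᶜ • w) + b • (y + infDist y Ωᶜ • w)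
        = (a • x + b • y) + R • w := by rw [hR]; module
    rw [h2, h1]; abel
  rwa [this] at hmem

/-- Increments of a concave function decrease along a line. -/
theorem ConcaveOn.add_le_add_of_collinear {E : Type*} [AddCommGroup E] [Module ℝ E]
    {Ω : Set E} {u : E → ℝ} (hu : ConcaveOn ℝ Ω u) {x v : E} {h t : ℝ} (hh : 0 < h) (ht : 0 < t)
    (hx : x ∈ Ω) (hx' : x + (h + t) • v ∈ Ω) :
    u (x + (h + t) • v) + u x ≤ u (x + t • v) + u (x + h • v) := by
  have hs : 0 < h + t := add_pos hh ht
  have e1 : h / (h + t) + t / (h + t) = 1 := by field_simp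
  have h1 := hu.2 hx hx' (by positivity) (by positivity) e1
  have h2 := hu.2 hx hx' (by positivity) (by positivity) ((add_comm _ _).trans e1)
  have p1 : (h / (h + t)) • x + (t / (h + t)) • (x + (h + t) • v) = x + t • v := by
    rw [smul_add, ← add_assoc, ← add_smul, e1, one_smul, smul_smul, div_mul_cancel₀ _ hs.ne']
  have p2 : (t / (h + t)) • x + (h / (h + t)) • (x + (h + t) • v) = x + h • v := by
    rw [smul_add, ← add_assoc, ← add_smul, add_comm (t / _), e1, one_smul, smul_smul,
      div_mul_cancel₀ _ hs.ne']
  rw [p1] at h1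
  rw [p2] at h2
  simp only [smul_eq_mul] at h1 h2
  have e2 : h / (h + t) = 1 - t / (h + t) := by linarith
  rw [e2] at h1 h2
  nlinarith

theorem lineDeriv_eq_zero_of_notMem_tsupport {E : Type*} [NormedAddCommGroup E] [NormedSpace ℝ E]
    {g : E → ℝ} {x : E} (hx : x ∉ tsupport g) (v : E) : lineDeriv ℝ g x v = 0 := by
  have h := (notMem_tsupport_iff_eventuallyEq.1 hx).lineDeriv_eq (𝕜 := ℝ) (v := v)
  rw [h]
  simp [lineDeriv]

section Integral

variable {E : Type*} [NormedAddCommGroup E] [NormedSpace ℝ E] [MeasurableSpace E] [BorelSpace E]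

theorem LipschitzWith.integrable_lineDeriv {g : E → ℝ} {C : ℝ≥0} (hg : LipschitzWith C g)
    (hgc : HasCompactSupport g) (μ : Measure E) [IsFiniteMeasureOnCompacts μ] (v : E) :
    Integrable (fun x ↦ lineDeriv ℝ g x v) μ := by
  have hs : HasCompactSupport fun x ↦ lineDeriv ℝ g x v :=
    HasCompactSupport.intro hgc fun x hx ↦ lineDeriv_eq_zero_of_notMem_tsupport hx v
  exact memLp_one_iff_integrable.1 <| hs.memLp_of_bound
    (aestronglyMeasurable_lineDeriv hg.continuous μ) (C * ‖v‖)
    (.of_forall fun _ ↦ norm_lineDeriv_le_of_lipschitz ℝ hg)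

/-- A Lipschitz function which is concave on `Ω` has nonpositive pure second distributional
derivatives in `Ω`. -/
theorem ConcaveOn.integral_lineDeriv_mul_lineDeriv_nonneg [FiniteDimensional ℝ E]
    {μ : Measure E} [μ.IsAddHaarMeasure]
    {Ω : Set E} {u g : E → ℝ} {C D : ℝ≥0} (hu : ConcaveOn ℝ Ω u) (huL : LipschitzWith C u)
    (hg : LipschitzWith D g) (hgc : HasCompactSupport g) (hg0 : ∀ x, 0 ≤ g x)
    {ε : ℝ} (hε : 0 < ε) (hgΩ : ∀ x, g x ≠ 0 → ball x ε ⊆ Ω) (v : E) :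
    0 ≤ ∫ x, lineDeriv ℝ u x v * lineDeriv ℝ g x v ∂μ := by
  have hlim := huL.integral_inv_smul_sub_mul_tendsto_integral_lineDeriv_mul (μ := μ)
    (hg.integrable_lineDeriv hgc μ v) v
  refine ge_of_tendsto hlim ?_
  obtain ⟨r, hr, hrv⟩ : ∃ r : ℝ, 0 < r ∧ 2 * r * ‖v‖ < ε := by
    refine ⟨ε / (2 * (‖v‖ + 1)), by positivity, ?_⟩
    have : 2 * (ε / (2 * (‖v‖ + 1))) * ‖v‖ = ε * (‖v‖ / (‖v‖ + 1)) := by field_simp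
    rw [this]
    exact mul_lt_of_lt_one_right hε ((div_lt_one (by positivity)).2 (by linarith))
  filter_upwards [Ioo_mem_nhdsGT hr] with h hh
  set w : E → ℝ := fun x ↦ u (x + h • v) - u x with hwdef
  have hw : LipschitzWith (C + C) w :=
    (LipschitzWith.of_dist_le_mul fun x y ↦ by
      simpa using huL.dist_le_mul (x + h • v) (y + h • v)).sub huL
  have hparts := LipschitzWith.integral_lineDeriv_mul_eq (μ := μ) hw hg hgc v
  have hle : ∫ x, lineDeriv ℝ w x v * g x ∂μ ≤ 0 := by
    refine integral_nonpos fun x ↦ ?_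
    by_cases hx : g x = 0
    · simp [hx]
    refine mul_nonpos_of_nonpos_of_nonneg ?_ (hg0 x)
    by_cases hd : LineDifferentiableAt ℝ w x v
    · refine le_of_tendsto hd.hasLineDerivAt.tendsto_slope_zero_right ?_
      filter_upwards [Ioo_mem_nhdsGT hr] with t ht
      have hxΩ : x ∈ Ω := hgΩ x hx (mem_ball_self hε)
      have hx' : x + (h + t) • v ∈ Ω := by
        refine hgΩ x hx ?_
        rw [mem_ball, dist_eq_norm, add_sub_cancel_left, norm_smul,
          Real.norm_of_nonneg (by linarith [hh.1, ht.1])]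
        refine lt_of_le_of_lt ?_ hrv
        gcongr
        linarith [hh.2, ht.2]
      have := hu.add_le_add_of_collinear hh.1 ht.1 hxΩ hx'
      have e : x + t • v + h • v = x + (h + t) • v := by module
      refine smul_nonpos_of_nonneg_of_nonpos (inv_nonneg.2 ht.1.le) ?_
      simp only [hwdef, e]
      linarith
    · rw [lineDeriv_zero_of_not_lineDifferentiableAt hd]
  have heq : ∫ x, (h⁻¹ • (u (x + h • v) - u x)) * lineDeriv ℝ g x v ∂μ
      = -(h⁻¹ * ∫ x, lineDeriv ℝ w x v * g x ∂μ) := by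
    rw [hparts, ← integral_const_mul, ← integral_neg]
    congr 1 with x
    rw [lineDeriv_neg]
    simp only [hwdef, smul_eq_mul]
    ring
  rw [heq, neg_nonneg]
  exact mul_nonpos_of_nonneg_of_nonpos (inv_nonneg.2 hh.1.le) hle

end Integral

/-- At a point of differentiability, the derivative of the distance to a closed set has norm at
least one. -/
theorem one_le_norm_fderiv_infDist {E : Type*} [NormedAddCommGroup E] [NormedSpace ℝ E]
    [ProperSpace E] {s : Set E} (hs : IsClosed s) (hne : s.Nonempty) {x : E}
    (hx : 0 < infDist x s) (hd : DifferentiableAt ℝ (fun y ↦ infDist y s) x) :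
    1 ≤ ‖fderiv ℝ (fun y ↦ infDist y s) x‖ := by
  obtain ⟨y, hy, hxy⟩ := hs.exists_infDist_eq_dist hne x
  have hlim := (hd.hasFDerivAt.hasLineDerivAt (y - x)).tendsto_slope_zero_right
  have hle : fderiv ℝ (fun y ↦ infDist y s) x (y - x) ≤ -infDist x s := by
    refine le_of_tendsto hlim ?_
    filter_upwards [Ioo_mem_nhdsGT (zero_lt_one' ℝ)] with t ht
    have h1 : infDist (x + t • (y - x)) s ≤ (1 - t) * infDist x s := by
      refine (infDist_le_dist_of_mem hy).trans_eq ?_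
      rw [hxy, dist_eq_norm, dist_eq_norm, ← Real.norm_of_nonneg (sub_nonneg.2 ht.2.le),
        ← norm_smul]
      congr 1
      module
    rw [smul_eq_mul, inv_mul_le_iff₀ ht.1]
    linarith
  have hop := (fderiv ℝ (fun y ↦ infDist y s) x).le_opNorm (y - x)
  rw [← dist_eq_norm, dist_comm, ← hxy] at hop
  have habs := neg_le_abs (fderiv ℝ (fun y ↦ infDist y s) x (y - x))
  rw [← Real.norm_eq_abs] at habs
  nlinarith

/-- The product of two bounded real Lipschitz functions is Lipschitz. -/
theorem LipschitzWith.mul_of_bounded {X : Type*} [PseudoMetricSpace X] {f g : X → ℝ} {A B : ℝ≥0}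
    (hf : LipschitzWith A f) (hg : LipschitzWith B g) {M N : ℝ≥0} (hM : ∀ x, |f x| ≤ M)
    (hN : ∀ x, |g x| ≤ N) : LipschitzWith (A * N + M * B) fun x ↦ f x * g x := by
  refine LipschitzWith.of_dist_le_mul fun x y ↦ ?_
  have h1 := hf.dist_le_mul x y
  have h2 := hg.dist_le_mul x y
  rw [Real.dist_eq] at h1 h2 ⊢
  calc |f x * g x - f y * g y| = |(f x - f y) * g x + f y * (g x - g y)| := by ring_nf
    _ ≤ |f x - f y| * |g x| + |f y| * |g x - g y| := by
      rw [← abs_mul, ← abs_mul]; exact abs_add_le _ _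
    _ ≤ (A * dist x y) * N + M * (B * dist x y) := by
      gcongr
      exacts [hN x, hM y]
    _ = ↑(A * N + M * B) * dist x y := by push_cast; ring

/-- Nonpositive powers are Lipschitz away from zero. -/
theorem exists_lipschitzOnWith_rpow_Ici {ε : ℝ} (hε : 0 < ε) {p : ℝ} (hp : p ≤ 0) :
    ∃ C : ℝ≥0, LipschitzOnWith C (fun t : ℝ ↦ t ^ p) (Ici ε) := by
  refine ⟨‖p * ε ^ (p - 1)‖₊, Convex.lipschitzOnWith_of_nnnorm_hasDerivWithin_le
    (f' := fun t ↦ p * t ^ (p - 1)) (convex_Ici ε) (fun t ht ↦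
      (Real.hasDerivAt_rpow_const (Or.inl (hε.trans_le ht).ne')).hasDerivWithinAt) fun t ht ↦ ?_⟩
  rw [nnnorm_mul, nnnorm_mul]
  gcongr
  rw [← NNReal.coe_le_coe, coe_nnnorm, coe_nnnorm,
    Real.norm_of_nonneg (Real.rpow_nonneg (hε.le.trans ht) _),
    Real.norm_of_nonneg (Real.rpow_nonneg hε.le _)]
  exact Real.rpow_le_rpow_of_nonpos hε ht (by linarith)

/-- In Euclidean space, the sum of the products of the coordinate derivatives is bounded by the
product of the norms. -/
theorem abs_sum_apply_basisFun_mul_le {d : ℕ} (S T : EuclideanSpace ℝ (Fin d) →L[ℝ] ℝ) :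
    |∑ i, S (EuclideanSpace.basisFun (Fin d) ℝ i) * T (EuclideanSpace.basisFun (Fin d) ℝ i)|
      ≤ ‖S‖ * ‖T‖ := by
  set D := InnerProductSpace.toDual ℝ (EuclideanSpace ℝ (Fin d))
  have h := (EuclideanSpace.basisFun (Fin d) ℝ).sum_inner_mul_inner (D.symm S) (D.symm T)
  have h' : ∑ i, S (EuclideanSpace.basisFun (Fin d) ℝ i) * T (EuclideanSpace.basisFun (Fin d) ℝ i)
      = inner ℝ (D.symm S) (D.symm T) := by
    rw [← h]
    refine Finset.sum_congr rfl fun i _ ↦ ?_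
    rw [InnerProductSpace.toDual_symm_apply, real_inner_comm, InnerProductSpace.toDual_symm_apply]
  rw [h']
  simpa using abs_real_inner_le_norm (D.symm S) (D.symm T)

theorem sum_apply_basisFun_mul_self {d : ℕ} (S : EuclideanSpace ℝ (Fin d) →L[ℝ] ℝ) :
    ∑ i, S (EuclideanSpace.basisFun (Fin d) ℝ i) * S (EuclideanSpace.basisFun (Fin d) ℝ i)
      = ‖S‖ ^ 2 := by
  set D := InnerProductSpace.toDual ℝ (EuclideanSpace ℝ (Fin d))
  have h := (EuclideanSpace.basisFun (Fin d) ℝ).sum_inner_mul_inner (D.symm S) (D.symm S)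
  rw [real_inner_self_eq_norm_sq, LinearIsometryEquiv.norm_map] at h
  rw [← h]
  refine Finset.sum_congr rfl fun i _ ↦ ?_
  rw [InnerProductSpace.toDual_symm_apply, real_inner_comm, InnerProductSpace.toDual_symm_apply]

/-- The `L²` norm of a continuous compactly supported function is the root of an integral. -/
theorem eLpNorm_two_eq_sqrt_integral {X : Type*} [TopologicalSpace X] [MeasurableSpace X]
    [OpensMeasurableSpace X] {μ : Measure X} [IsFiniteMeasureOnCompacts μ] {f : X → ℝ}
    (hf : Continuous f) (hfc : HasCompactSupport f) :
    eLpNorm f 2 μ = ENNReal.ofReal √(∫ x, f x ^ 2 ∂μ) := by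
  rw [(hf.memLp_of_hasCompactSupport hfc).eLpNorm_eq_integral_rpow_norm (by simp) (by simp),
    Real.sqrt_eq_rpow]
  simp

theorem exists_pos_lt_of_isCompact {X : Type*} [TopologicalSpace X] {K : Set X} (hK : IsCompact K)
    {u : X → ℝ} (hu : ContinuousOn u K) (hpos : ∀ x ∈ K, 0 < u x) :
    ∃ ε > 0, ∀ x ∈ K, ε < u x := by
  rcases K.eq_empty_or_nonempty with rfl | hne
  · exact ⟨1, one_pos, by simp⟩
  · obtain ⟨y, hy, hmin⟩ := hK.exists_isMinOn hne hu
    exact ⟨u y / 2, half_pos (hpos y hy), fun x hx ↦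
      (half_lt_self (hpos y hy)).trans_le (hmin hx)⟩

/-- Pointwise estimate behind the weighted Hardy inequality, at a point where the weight `u` has
unit gradient. -/
theorem sum_lineDeriv_mul_lineDeriv_rpow_mul_sq_le {d : ℕ} {u φ : EuclideanSpace ℝ (Fin d) → ℝ}
    {x : EuclideanSpace ℝ (Fin d)} {δ : ℝ} (hδ : δ < 1) (hux : 0 < u x)
    (hu : DifferentiableAt ℝ u x) (hnorm : ‖fderiv ℝ u x‖ = 1) (hφ : DifferentiableAt ℝ φ x) :
    ∑ i, lineDeriv ℝ u x (EuclideanSpace.basisFun (Fin d) ℝ i) *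
        lineDeriv ℝ (fun y ↦ u y ^ (δ - 1) * φ y ^ 2) x (EuclideanSpace.basisFun (Fin d) ℝ i)
      ≤ -((1 - δ) / 2) * (u x ^ (δ / 2 - 1) * φ x) ^ 2
        + 2 / (1 - δ) * (u x ^ (δ / 2) * ‖fderiv ℝ φ x‖) ^ 2 := by
  set e := EuclideanSpace.basisFun (Fin d) ℝ
  set S := fderiv ℝ u x
  set T := fderiv ℝ φ x
  set p := u x ^ (δ / 2 - 1) with hp
  set q := u x ^ (δ / 2) with hq
  have hpq : u x ^ (δ - 1) = p * q := by
    rw [hp, hq, ← Real.rpow_add hux]; ring_nf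
  have hpp : u x ^ (δ - 1 - 1) = p * p := by
    rw [hp, ← Real.rpow_add hux]; ring_nf
  have hg : HasFDerivAt (fun y ↦ u y ^ (δ - 1) * φ y ^ 2)
      (((δ - 1) * (p * p) * φ x ^ 2) • S + (2 * (p * q) * φ x) • T) x := by
    have h1 := (hu.hasFDerivAt.rpow_const (p := δ - 1) (Or.inl hux.ne')).mul
      (hφ.hasFDerivAt.pow 2)
    refine h1.congr_fderiv ?_
    ext v
    simp only [hpq, hpp, add_apply, smul_apply,
      smul_eq_mul]
    push_cast
    ring
  have hsum : ∑ i, lineDeriv ℝ u x (e i) * lineDeriv ℝ (fun y ↦ u y ^ (δ - 1) * φ y ^ 2) x (e i)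
      = (δ - 1) * (p * p) * φ x ^ 2 * ∑ i, S (e i) * S (e i)
        + 2 * (p * q) * φ x * ∑ i, S (e i) * T (e i) := by
    rw [Finset.mul_sum, Finset.mul_sum, ← Finset.sum_add_distrib]
    refine Finset.sum_congr rfl fun i _ ↦ ?_
    rw [(hg.hasLineDerivAt (e i)).lineDeriv, (hu.hasFDerivAt.hasLineDerivAt (e i)).lineDeriv]
    simp only [add_apply, smul_apply, smul_eq_mul]
    ring
  have hp0 : 0 < p := Real.rpow_pos_of_pos hux _
  have hq0 : 0 < q := Real.rpow_pos_of_pos hux _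
  have hST : φ x * ∑ i, S (e i) * T (e i) ≤ |φ x| * ‖T‖ := by
    refine (le_abs_self _).trans ?_
    rw [abs_mul]
    gcongr
    simpa only [hnorm, one_mul] using abs_sum_apply_basisFun_mul_le S T
  rw [hsum, sum_apply_basisFun_mul_self, hnorm]
  have hc : 0 < 1 - δ := by linarith
  have hyoung : 2 * (p * q) * (|φ x| * ‖T‖)
      ≤ (1 - δ) / 2 * (p * φ x) ^ 2 + 2 / (1 - δ) * (q * ‖T‖) ^ 2 := by
    have key : (1 - δ) / 2 * (p * φ x) ^ 2 + 2 / (1 - δ) * (q * ‖T‖) ^ 2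
        - 2 * (p * q) * (|φ x| * ‖T‖)
        = (2 * (1 - δ))⁻¹ * ((1 - δ) * (p * |φ x|) - 2 * (q * ‖T‖)) ^ 2 := by
      rw [mul_pow p (φ x), ← sq_abs (φ x)]
      field_simp
      ring
    have : 0 ≤ (2 * (1 - δ))⁻¹ * ((1 - δ) * (p * |φ x|) - 2 * (q * ‖T‖)) ^ 2 := by positivity
    linarith
  have := mul_le_mul_of_nonneg_left hST (by positivity : 0 ≤ 2 * (p * q))
  nlinarith

/-- If `Ω ⊂ ℝ^d` is a convex domain and `δ ∈ [0,1)` then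
`‖d_Γ^{δ/2-1}φ‖₂ ≤ (2/(1-δ)) ‖d_Γ^{δ/2}|∇φ|‖₂` for all `φ ∈ C_c^1(Ω)`:
the weighted Hardy inequality holds on all of `Ω` with constant `2/(1-δ)`. -/
theorem stmt16 {d : ℕ} (hd : 1 ≤ d) (Ω : Set (EuclideanSpace ℝ (Fin d)))
    (hΩ : IsDomainSet Ω) (hconv : Convex ℝ Ω)
    (δ : ℝ) (hδ : δ ∈ Set.Ico (0:ℝ) 1)
    (φ : EuclideanSpace ℝ (Fin d) → ℝ) (hφ : IsCc1 Ω φ) :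
    wNorm Ω (δ/2 - 1) φ ≤ ENNReal.ofReal (2 / (1 - δ)) * wGradNorm Ω (δ/2) φ := by
  obtain ⟨ho, hcon, hne⟩ := hΩ
  obtain ⟨hφ1, hφc, hφs⟩ := hφ
  have hc : 0 < 1 - δ := sub_pos.2 hδ.2
  set u : EuclideanSpace ℝ (Fin d) → ℝ := fun x ↦ infDist x (frontier Ω) with hu
  have hfr : (frontier Ω).Nonempty := nonempty_frontier_iff.2 ⟨hcon.nonempty, hne⟩
  have huL : LipschitzWith 1 u := lipschitz_infDist_pt _
  have hueq : ∀ x ∈ Ω, infDist x Ωᶜ = u x := fun x hx ↦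
    (infDist_frontier_eq_infDist_compl ho hne hx).symm
  have hconc : ConcaveOn ℝ Ω u := (hconv.concaveOn_infDist_compl hne).congr hueq
  have hpos : ∀ x ∈ Ω, 0 < u x := fun x hx ↦
    (isClosed_frontier.notMem_iff_infDist_pos hfr).1 fun h ↦
      disjoint_left.1 (disjoint_frontier_iff_isOpen.2 ho) h hx
  have hball : ∀ x ∈ Ω, ball x (u x) ⊆ Ω := fun x hx ↦
    hueq x hx ▸ ball_infDist_compl_subset
  obtain ⟨ε, hε, hεu⟩ := exists_pos_lt_of_isCompact hφc huL.continuous.continuousOn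
    fun x hx ↦ hpos x (hφs hx)
  -- The weight, truncated away from the support of `φ` to be globally positive.
  set D : EuclideanSpace ℝ (Fin d) → ℝ := fun x ↦ max (u x) ε with hD
  have hDε : ∀ x, ε ≤ D x := fun x ↦ le_max_right _ _
  have hDpos : ∀ x, 0 < D x := fun x ↦ hε.trans_le (hDε x)
  have hDL : LipschitzWith 1 D := huL.max_const ε
  have hDu : ∀ x ∈ tsupport φ, D x = u x := fun x hx ↦ max_eq_left (hεu x hx).le
  have hDc : ∀ p : ℝ, Continuous fun x ↦ D x ^ p := fun p ↦
    hDL.continuous.rpow_const fun x ↦ Or.inl (hDpos x).ne'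
  have hφ0 : ∀ x ∉ tsupport φ, φ x = 0 := fun x hx ↦ image_eq_zero_of_notMem_tsupport hx
  have hφ'0 : ∀ x ∉ tsupport φ, fderiv ℝ φ x = 0 := fun x hx ↦
    fderiv_of_notMem_tsupport ℝ hx
  set a : EuclideanSpace ℝ (Fin d) → ℝ := fun x ↦ D x ^ (δ / 2 - 1) * φ x with ha
  set b : EuclideanSpace ℝ (Fin d) → ℝ := fun x ↦ D x ^ (δ / 2) * ‖fderiv ℝ φ x‖ with hb
  have ha0 : ∀ x ∉ tsupport φ, a x = 0 := fun x hx ↦ by simp [ha, hφ0 x hx]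
  have hb0 : ∀ x ∉ tsupport φ, b x = 0 := fun x hx ↦ by simp [hb, hφ'0 x hx]
  have hacont : Continuous a := (hDc _).mul hφ1.continuous
  have hbcont : Continuous b := (hDc _).mul (hφ1.continuous_fderiv one_ne_zero).norm
  have hac : HasCompactSupport a := .intro hφc ha0
  have hbc : HasCompactSupport b := .intro hφc hb0
  have hwa : wNorm Ω (δ / 2 - 1) φ = eLpNorm a 2 volume := by
    unfold wNorm L2N distB
    congr 1 with x
    by_cases hx : x ∈ tsupport φ
    · simp only [ha, hDu x hx, hu]
    · simp [ha, hφ0 x hx]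
  have hwb : wGradNorm Ω (δ / 2) φ = eLpNorm b 2 volume := by
    unfold wGradNorm L2N distB
    congr 1 with x
    by_cases hx : x ∈ tsupport φ
    · simp only [hb, hDu x hx, hu]
    · simp [hb, hφ'0 x hx]
  have hai : Integrable (fun x ↦ a x ^ 2) volume :=
    (hacont.pow 2).integrable_of_hasCompactSupport (.intro hφc fun x hx ↦ by simp [ha0 x hx])
  have hbi : Integrable (fun x ↦ b x ^ 2) volume :=
    (hbcont.pow 2).integrable_of_hasCompactSupport (.intro hφc fun x hx ↦ by simp [hb0 x hx])
  set g : EuclideanSpace ℝ (Fin d) → ℝ := fun x ↦ D x ^ (δ - 1) * φ x ^ 2 with hg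
  have hg0 : ∀ x ∉ tsupport φ, g x = 0 := fun x hx ↦ by simp [hg, hφ0 x hx]
  have hgc : HasCompactSupport g := .intro hφc hg0
  obtain ⟨L, hgL⟩ : ∃ L, LipschitzWith L g := by
    obtain ⟨C, hC⟩ := exists_lipschitzOnWith_rpow_Ici hε (p := δ - 1) (by linarith)
    have hDp : LipschitzWith (C * 1) fun x ↦ D x ^ (δ - 1) :=
      lipschitzOnWith_univ.1 (hC.comp (lipschitzOnWith_univ.2 hDL) fun x _ ↦ hDε x)
    have hsqc : HasCompactSupport fun x ↦ φ x ^ 2 := .intro hφc fun x hx ↦ by simp [hφ0 x hx]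
    obtain ⟨B, hB⟩ := (hφ1.pow 2).lipschitzWith_of_hasCompactSupport hsqc one_ne_zero
    obtain ⟨N, hN⟩ := hsqc.exists_bound_of_continuous (hφ1.continuous.pow 2)
    have hN0 : 0 ≤ N := (norm_nonneg _).trans (hN 0)
    refine ⟨_, hDp.mul_of_bounded hB (M := ⟨ε ^ (δ - 1), by positivity⟩) (N := ⟨N, hN0⟩)
      (fun x ↦ ?_) fun x ↦ hN x⟩
    rw [abs_of_nonneg (Real.rpow_nonneg (hDpos x).le _)]
    exact Real.rpow_le_rpow_of_nonpos hε (hDε x) (by linarith)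
  set e := EuclideanSpace.basisFun (Fin d) ℝ with he
  have hint : ∀ i, Integrable (fun x ↦ lineDeriv ℝ u x (e i) * lineDeriv ℝ g x (e i)) volume :=
    fun i ↦ (hgL.integrable_lineDeriv hgc volume (e i)).bdd_mul
      (aestronglyMeasurable_lineDeriv huL.continuous volume)
      (.of_forall fun _ ↦ norm_lineDeriv_le_of_lipschitz ℝ huL)
  have hnonneg : 0 ≤ ∫ x, ∑ i, lineDeriv ℝ u x (e i) * lineDeriv ℝ g x (e i) := by
    rw [integral_finsetSum _ fun i _ ↦ hint i]
    refine Finset.sum_nonneg fun i _ ↦ ?_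
    refine hconc.integral_lineDeriv_mul_lineDeriv_nonneg huL hgL hgc (fun x ↦ ?_) hε
      (fun x hx ↦ ?_) (e i)
    · exact mul_nonneg (Real.rpow_nonneg (hDpos x).le _) (sq_nonneg _)
    · have hx' : x ∈ tsupport φ := by_contra fun h ↦ hx (hg0 x h)
      exact (ball_subset_ball (hεu x hx').le).trans (hball x (hφs hx'))
  have hpt : ∀ᵐ x, ∑ i, lineDeriv ℝ u x (e i) * lineDeriv ℝ g x (e i)
      ≤ -((1 - δ) / 2) * a x ^ 2 + 2 / (1 - δ) * b x ^ 2 := by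
    filter_upwards [huL.ae_differentiableAt] with x hdiff
    by_cases hx : x ∈ tsupport φ
    · have hux := hpos x (hφs hx)
      have hnorm : ‖fderiv ℝ u x‖ = 1 :=
        le_antisymm (by simpa using norm_fderiv_le_of_lipschitz ℝ huL)
          (one_le_norm_fderiv_infDist isClosed_frontier hfr hux hdiff)
      have hev : g =ᶠ[𝓝 x] fun y ↦ u y ^ (δ - 1) * φ y ^ 2 := by
        filter_upwards [huL.continuous.continuousAt.eventually (lt_mem_nhds (hεu x hx))] with y hy
        simp only [hg, hD, max_eq_left hy.le]
      have := sum_lineDeriv_mul_lineDeriv_rpow_mul_sq_le hδ.2 hux hdiff hnorm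
        (hφ1.differentiable one_ne_zero x)
      simpa only [hev.lineDeriv_eq, ha, hb, hDu x hx] using this
    · have hxg : x ∉ tsupport g := fun h ↦
        hx (closure_minimal (s := Function.support g) (fun y hy ↦ by_contra fun h' ↦ hy (hg0 y h'))
          (isClosed_tsupport φ) h)
      simp [lineDeriv_eq_zero_of_notMem_tsupport hxg, ha0 x hx, hb0 x hx]
  have hmain : ∫ x, a x ^ 2 ≤ (2 / (1 - δ)) ^ 2 * ∫ x, b x ^ 2 := by
    have h := hnonneg.trans (integral_mono_ae (integrable_finsetSum _ fun i _ ↦ hint i)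
      ((hai.const_mul _).add (hbi.const_mul _)) hpt)
    simp only [Pi.add_apply] at h
    rw [integral_add (hai.const_mul _) (hbi.const_mul _), integral_const_mul,
      integral_const_mul] at h
    have h2 : (1 - δ) / 2 * ∫ x, a x ^ 2 ≤ 2 / (1 - δ) * ∫ x, b x ^ 2 := by linarith
    have h3 := mul_le_mul_of_nonneg_left h2 (by positivity : 0 ≤ 2 / (1 - δ))
    have h4 : 2 / (1 - δ) * ((1 - δ) / 2 * ∫ x, a x ^ 2) = ∫ x, a x ^ 2 := by field_simp
    rw [h4] at h3
    linarith
  rw [hwa, hwb, eLpNorm_two_eq_sqrt_integral hacont hac, eLpNorm_two_eq_sqrt_integral hbcont hbc,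
    ← ENNReal.ofReal_mul (by positivity)]
  refine ENNReal.ofReal_le_ofReal ((Real.sqrt_le_sqrt hmain).trans_eq ?_)
  rw [Real.sqrt_mul (by positivity), Real.sqrt_sq (by positivity)]
end
end

section
/- Let K be a nonempty closed convex subset of ℝ^d with nonempty interior and K ≠ ℝ^d, let Ω = ℝ^d \ K, Γ = ∂Ω, and let δ > 1. Then (δ−1)‖d_Γ^{δ/2−1}φ‖_2 ≤ 2‖d_Γ^{δ/2}|∇φ|‖_2 for all φ ∈ C_c^1(Ω); moreover this constant is optimal: a_δ(Ω) = a_δ(Γ) = 2/(δ−1). -/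
open MeasureTheory Metric Set ENNReal RealInnerProductSpace

noncomputable section

section ConvexDistance

open Filter Topology

variable {E : Type*} [NormedAddCommGroup E] [InnerProductSpace ℝ E] [FiniteDimensional ℝ E]
  {K : Set E}

lemma exists_metric_projection (hne : K.Nonempty) (hcl : IsClosed K) (hconv : Convex ℝ K) (x : E) :
    ∃ p ∈ K, infDist x K = ‖x - p‖ ∧ ∀ k ∈ K, ⟪x - p, k - p⟫ ≤ 0 := by
  obtain ⟨p, hp, hpx⟩ := hcl.exists_infDist_eq_dist hne x
  refine ⟨p, hp, by rw [hpx, dist_eq_norm], ?_⟩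
  rw [← norm_eq_iInf_iff_real_inner_le_zero hconv hp]
  rw [← dist_eq_norm, ← hpx, infDist_eq_iInf]
  simp only [dist_eq_norm]

/-- A nearest-point projection onto a closed convex set. -/
def nearestPt (hne : K.Nonempty) (hcl : IsClosed K) (hconv : Convex ℝ K) (x : E) : E :=
  (exists_metric_projection hne hcl hconv x).choose

lemma nearestPt_mem (hne : K.Nonempty) (hcl : IsClosed K) (hconv : Convex ℝ K)
    (x : E) : nearestPt hne hcl hconv x ∈ K :=
  (exists_metric_projection hne hcl hconv x).choose_spec.1

lemma infDist_eq_norm_sub_nearestPt (hne : K.Nonempty) (hcl : IsClosed K) (hconv : Convex ℝ K)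
    (x : E) :
    infDist x K = ‖x - nearestPt hne hcl hconv x‖ :=
  (exists_metric_projection hne hcl hconv x).choose_spec.2.1

lemma inner_sub_nearestPt_le (hne : K.Nonempty) (hcl : IsClosed K) (hconv : Convex ℝ K)
    (x : E) {k : E} (hk : k ∈ K) :
    ⟪x - nearestPt hne hcl hconv x, k - nearestPt hne hcl hconv x⟫ ≤ 0 :=
  (exists_metric_projection hne hcl hconv x).choose_spec.2.2 k hk

lemma lipschitzWith_nearestPt (hne : K.Nonempty) (hcl : IsClosed K) (hconv : Convex ℝ K) :
    LipschitzWith 1 (nearestPt hne hcl hconv) := by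
  refine LipschitzWith.of_dist_le_mul fun x y => ?_
  have h1 := inner_sub_nearestPt_le hne hcl hconv x (nearestPt_mem hne hcl hconv y)
  have h2 := inner_sub_nearestPt_le hne hcl hconv y (nearestPt_mem hne hcl hconv x)
  set p := nearestPt hne hcl hconv x
  set q := nearestPt hne hcl hconv y
  rw [dist_eq_norm, dist_eq_norm, NNReal.coe_one, one_mul]
  have h3 : ‖p - q‖ * ‖p - q‖ ≤ ⟪x - y, p - q⟫ := by
    rw [← real_inner_self_eq_norm_mul_norm]
    have : ⟪x - y, p - q⟫ - ⟪p - q, p - q⟫ = -⟪x - p, q - p⟫ - ⟪y - q, p - q⟫ := by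
      simp only [inner_sub_left, inner_sub_right]; ring
    linarith
  have h4 := h3.trans (real_inner_le_norm _ _)
  by_contra! hlt
  have h5 : 0 < ‖p - q‖ := (norm_nonneg _).trans_lt hlt
  nlinarith

lemma hasFDerivAt_infDist_sq (hne : K.Nonempty) (hcl : IsClosed K) (hconv : Convex ℝ K) (x : E) :
    HasFDerivAt (fun y => infDist y K ^ 2)
      ((2 : ℝ) • innerSL ℝ (x - nearestPt hne hcl hconv x)) x := by
  have key : ∀ y, |infDist y K ^ 2 - infDist x K ^ 2 -
      2 * ⟪x - nearestPt hne hcl hconv x, y - x⟫| ≤ ‖y - x‖ ^ 2 := by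
    intro y
    have h1 := inner_sub_nearestPt_le hne hcl hconv x (nearestPt_mem hne hcl hconv y)
    have h3 : infDist y K ≤ ‖y - nearestPt hne hcl hconv x‖ := by
      rw [← dist_eq_norm]; exact infDist_le_dist_of_mem (nearestPt_mem hne hcl hconv x)
    have h4 : infDist y K ^ 2 ≤ ‖y - nearestPt hne hcl hconv x‖ ^ 2 := by
      gcongr
      exact infDist_nonneg
    have h5 := infDist_eq_norm_sub_nearestPt hne hcl hconv y
    rw [infDist_eq_norm_sub_nearestPt hne hcl hconv x]
    set p := nearestPt hne hcl hconv x
    set q := nearestPt hne hcl hconv y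
    have h6 : ‖y - p‖ ^ 2 = ‖x - p‖ ^ 2 + 2 * ⟪x - p, y - x⟫ + ‖y - x‖ ^ 2 := by
      rw [← norm_add_sq_real]; congr 2; abel
    have h7 : ‖y - q‖ ^ 2 = ‖x - p‖ ^ 2 + 2 * ⟪x - p, (y - q) - (x - p)⟫
        + ‖(y - q) - (x - p)‖ ^ 2 := by
      rw [← norm_add_sq_real]; congr 2; abel
    have h8 : ⟪x - p, (y - q) - (x - p)⟫ = ⟪x - p, y - x⟫ - ⟪x - p, q - p⟫ := by
      rw [← inner_sub_right]; congr 1; abel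
    rw [abs_le]
    constructor
    · rw [h5, h7, h8]
      nlinarith [sq_nonneg ‖(y - q) - (x - p)‖, sq_nonneg ‖y - x‖]
    · linarith
  refine HasFDerivAt.of_isLittleO ?_
  have hO : (fun y => infDist y K ^ 2 - infDist x K ^ 2 -
      ((2 : ℝ) • innerSL ℝ (x - nearestPt hne hcl hconv x)) (y - x)) =O[𝓝 x]
      fun y => ‖y - x‖ ^ 2 := by
    refine Asymptotics.IsBigO.of_bound 1 (Eventually.of_forall fun y => ?_)
    simpa only [one_mul, Real.norm_eq_abs, norm_pow, abs_norm, smul_apply,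
      smul_eq_mul, innerSL_apply_apply] using key y
  refine hO.trans_isLittleO ?_
  have := (Asymptotics.isLittleO_norm_pow_id (E' := E) one_lt_two)
  have h2 : Tendsto (fun y => y - x) (𝓝 x) (𝓝 0) := by
    have : Tendsto (fun y => y - x) (𝓝 x) (𝓝 (x - x)) := tendsto_id.sub_const x
    simpa using this
  exact this.comp_tendsto h2

lemma contDiff_infDist_sq (hne : K.Nonempty) (hcl : IsClosed K) (hconv : Convex ℝ K) :
    ContDiff ℝ 1 (fun y => infDist y K ^ 2) := by
  rw [contDiff_one_iff_fderiv]
  refine ⟨fun x => (hasFDerivAt_infDist_sq hne hcl hconv x).differentiableAt, ?_⟩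
  have : fderiv ℝ (fun y => infDist y K ^ 2) =
      fun x => (2 : ℝ) • innerSL ℝ (x - nearestPt hne hcl hconv x) :=
    funext fun x => (hasFDerivAt_infDist_sq hne hcl hconv x).fderiv
  rw [this]
  have := (lipschitzWith_nearestPt hne hcl hconv).continuous
  fun_prop

lemma contDiffAt_infDist (hne : K.Nonempty) (hcl : IsClosed K) (hconv : Convex ℝ K)
    {x : E} (hx : x ∉ K) : ContDiffAt ℝ 1 (fun y => infDist y K) x := by
  have h := (contDiff_infDist_sq hne hcl hconv).contDiffAt (x := x)
  have h2 := h.sqrt (pow_pos ((hcl.notMem_iff_infDist_pos hne).1 hx) 2).ne'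
  simpa [Real.sqrt_sq infDist_nonneg] using h2

lemma norm_gradient_infDist (hne : K.Nonempty) (hcl : IsClosed K) (hconv : Convex ℝ K)
    {x : E} (hx : x ∉ K) : ‖gradient (fun y => infDist y K) x‖ = 1 := by
  have hpos := (hcl.notMem_iff_infDist_pos hne).1 hx
  have h1 := hasFDerivAt_infDist_sq hne hcl hconv x
  have h2 := ((contDiffAt_infDist hne hcl hconv hx).differentiableAt one_ne_zero).hasFDerivAt.pow 2
  have h3 := h2.unique h1
  have h4 := congrArg (fun L => ‖L‖) h3
  simp only [norm_smul, innerSL_apply_norm, ← infDist_eq_norm_sub_nearestPt] at h4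
  have h5 : ‖fderiv ℝ (fun y => infDist y K) x‖ = 1 := by
    simp only [nsmul_eq_mul, Nat.cast_ofNat, Nat.add_one_sub_one, pow_one, norm_mul,
      Real.norm_ofNat, Real.norm_of_nonneg hpos.le] at h4
    exact mul_left_cancel₀ (mul_pos two_pos hpos).ne' (h4.trans (mul_one _).symm)
  rw [← h5, ← toDual_gradient, LinearIsometryEquiv.norm_map]

lemma convexOn_infDist (hne : K.Nonempty) (hcl : IsClosed K) (hconv : Convex ℝ K) :
    ConvexOn ℝ univ (fun y => infDist y K) := by
  refine ⟨convex_univ, fun x _ y _ a b ha hb hab => ?_⟩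
  have hm := hconv (nearestPt_mem hne hcl hconv x) (nearestPt_mem hne hcl hconv y) ha hb hab
  have h := infDist_le_dist_of_mem (x := a • x + b • y) hm
  refine h.trans ?_
  simp only [infDist_eq_norm_sub_nearestPt hne hcl hconv x,
    infDist_eq_norm_sub_nearestPt hne hcl hconv y, smul_eq_mul]
  rw [dist_eq_norm]
  have : a • x + b • y - (a • nearestPt hne hcl hconv x + b • nearestPt hne hcl hconv y) =
    a • (x - nearestPt hne hcl hconv x) + b • (y - nearestPt hne hcl hconv y) := by
    simp only [smul_sub]; abel
  rw [this]
  refine (norm_add_le _ _).trans ?_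
  rw [norm_smul, norm_smul, Real.norm_of_nonneg ha, Real.norm_of_nonneg hb]

end ConvexDistance

section ConvexFirstVariation

open Filter Topology

variable {E : Type*} [NormedAddCommGroup E] [InnerProductSpace ℝ E]
  [MeasurableSpace E] [BorelSpace E] {μ : Measure E} [μ.IsAddHaarMeasure]

lemma integral_sub_mul_sub_nonpos {f g : E → ℝ} (hf : ConvexOn ℝ univ f) (hfc : Continuous f)
    (hg : Continuous g) (hgs : HasCompactSupport g) (hg0 : ∀ x, 0 ≤ g x) (v : E) :
    ∫ x, (f (x + v) - f x) * (g (x + v) - g x) ∂μ ≤ 0 := by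
  have hgv : HasCompactSupport fun x => g (x + v) := hgs.comp_homeomorph (Homeomorph.addRight v)
  have i1 : Integrable (fun x => f (x + v) * g (x + v)) μ :=
    Continuous.integrable_of_hasCompactSupport (by fun_prop) hgv.mul_left
  have i2 : Integrable (fun x => f x * g x) μ :=
    Continuous.integrable_of_hasCompactSupport (by fun_prop) hgs.mul_left
  have i3 : Integrable (fun x => f (x + v) * g x) μ :=
    Continuous.integrable_of_hasCompactSupport (by fun_prop) hgs.mul_left
  have i4 : Integrable (fun x => f x * g (x + v)) μ :=
    Continuous.integrable_of_hasCompactSupport (by fun_prop) hgv.mul_left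
  have i5 : Integrable (fun x => f (x - v) * g x) μ :=
    Continuous.integrable_of_hasCompactSupport (by fun_prop) hgs.mul_left
  have e1 : ∫ x, f (x + v) * g (x + v) ∂μ = ∫ x, f x * g x ∂μ :=
    integral_add_right_eq_self (fun x => f x * g x) v
  have e2 : ∫ x, f x * g (x + v) ∂μ = ∫ x, f (x - v) * g x ∂μ := by
    rw [← integral_add_right_eq_self (fun x => f (x - v) * g x) v]
    simp
  have e3 : ∫ x, (f (x + v) - f x) * (g (x + v) - g x) ∂μ =
      ∫ x, (2 * f x - f (x + v) - f (x - v)) * g x ∂μ := by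
    have l : ∀ x, (f (x + v) - f x) * (g (x + v) - g x) =
      (f (x + v) * g (x + v) + f x * g x) - (f (x + v) * g x + f x * g (x + v)) := fun x => by ring
    have r : ∀ x, (2 * f x - f (x + v) - f (x - v)) * g x =
      (f x * g x + f x * g x) - (f (x + v) * g x + f (x - v) * g x) := fun x => by ring
    simp only [l, r]
    have s1 := integral_sub (i1.add i2) (i3.add i4)
    have s2 := integral_sub (i2.add i2) (i3.add i5)
    simp only [Pi.add_apply] at s1 s2
    rw [s1, s2, integral_add i1 i2, integral_add i3 i4, integral_add i2 i2, integral_add i3 i5, e1,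
      e2]
  rw [e3]
  refine integral_nonpos fun x => mul_nonpos_of_nonpos_of_nonneg ?_ (hg0 x)
  have h := hf.2 (mem_univ (x + v)) (mem_univ (x - v)) (by norm_num : (0 : ℝ) ≤ 1 / 2)
    (by norm_num : (0 : ℝ) ≤ 1 / 2) (by norm_num)
  have hx : (1 / 2 : ℝ) • (x + v) + (1 / 2 : ℝ) • (x - v) = x := by
    rw [← smul_add, add_add_sub_cancel, ← two_smul ℝ x, smul_smul]; norm_num
  rw [hx, smul_eq_mul, smul_eq_mul] at h
  linarith

variable [FiniteDimensional ℝ E]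

/-- If `f` is convex and Lipschitz then its distributional Laplacian is nonnegative in every
direction: tested against `g ≥ 0`, the integral of `∂ᵥ f ∂ᵥ g` is nonpositive. -/
lemma integral_fderiv_mul_fderiv_nonpos {f g : E → ℝ} {C : NNReal} (hf : ConvexOn ℝ univ f)
    (hfL : LipschitzWith C f) (hg : ContDiff ℝ 1 g) (hgs : HasCompactSupport g)
    (hg0 : ∀ x, 0 ≤ g x) (hd : ∀ x ∈ tsupport g, DifferentiableAt ℝ f x) (v : E) :
    ∫ x, fderiv ℝ f x v * fderiv ℝ g x v ∂μ ≤ 0 := by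
  obtain ⟨D, hgL⟩ := hg.lipschitzWith_of_hasCompactSupport hgs one_ne_zero
  have key : Tendsto (fun t : ℝ => ∫ x, (t⁻¹ * (f (x + t • v) - f x)) *
      (t⁻¹ * (g (x + t • v) - g x)) ∂μ) (𝓝[≠] 0)
      (𝓝 (∫ x, fderiv ℝ f x v * fderiv ℝ g x v ∂μ)) := by
    set S : Set E := cthickening ‖v‖ (tsupport g) with hS
    have hSc : IsCompact S := IsCompact.cthickening hgs
    refine tendsto_integral_filter_of_dominated_convergence
      (S.indicator fun _ => (C * ‖v‖) * (D * ‖v‖)) ?_ ?_ ?_ ?_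
    · refine Eventually.of_forall fun t => Continuous.aestronglyMeasurable ?_
      have := hfL.continuous
      have := hg.continuous
      fun_prop
    · have h1 : ∀ᶠ t : ℝ in 𝓝[≠] 0, |t| ≤ 1 := by
        refine nhdsWithin_le_nhds ?_
        filter_upwards [Metric.ball_mem_nhds (0 : ℝ) one_pos] with t ht
        exact (mem_ball_zero_iff.1 ht).le
      filter_upwards [h1, self_mem_nhdsWithin] with t ht ht0
      refine Eventually.of_forall fun x => ?_
      have bd : ∀ {h : E → ℝ} {B : NNReal}, LipschitzWith B h →
          ‖t⁻¹ * (h (x + t • v) - h x)‖ ≤ B * ‖v‖ := by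
        intro h B hB
        have := hB.dist_le_mul (x + t • v) x
        rw [dist_eq_norm, dist_eq_norm, add_sub_cancel_left, norm_smul] at this
        rw [norm_mul, norm_inv, inv_mul_le_iff₀ (norm_pos_iff.2 ht0)]
        linarith
      by_cases hx : x ∈ S
      · rw [indicator_of_mem hx, norm_mul]
        exact mul_le_mul (bd hfL) (bd hgL) (norm_nonneg _) (by positivity)
      · have g1 : g x = 0 := image_eq_zero_of_notMem_tsupport fun hx' =>
          hx (self_subset_cthickening _ hx')
        have g2 : g (x + t • v) = 0 := image_eq_zero_of_notMem_tsupport fun hx' => hx <| by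
          refine mem_cthickening_of_dist_le x _ _ _ hx' ?_
          rw [dist_eq_norm, sub_add_cancel_left, norm_neg, norm_smul]
          exact mul_le_of_le_one_left (norm_nonneg _) ht
        simp [g1, g2, indicator_of_notMem hx]
    · exact (integrable_indicator_iff hSc.measurableSet).2
        (integrableOn_const hSc.measure_lt_top.ne)
    · refine Eventually.of_forall fun x => ?_
      have hline : ∀ {h : E → ℝ}, DifferentiableAt ℝ h x →
          Tendsto (fun t : ℝ => t⁻¹ * (h (x + t • v) - h x)) (𝓝[≠] 0) (𝓝 (fderiv ℝ h x v)) := by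
        intro h hh
        simpa using (hh.hasFDerivAt.hasLineDerivAt v).tendsto_slope_zero
      have hgx := hline (hg.differentiable one_ne_zero x)
      by_cases hx : x ∈ tsupport g
      · exact (hline (hd x hx)).mul hgx
      · have hz : ∀ᶠ y in 𝓝 x, g y = 0 := by
          filter_upwards [(isClosed_tsupport g).isOpen_compl.mem_nhds hx] with y hy
          exact image_eq_zero_of_notMem_tsupport hy
        have hfd : fderiv ℝ g x = 0 := by
          rw [Filter.EventuallyEq.fderiv_eq (f₁ := g) (f := fun _ => 0) hz]
          simp
        have hcont : Tendsto (fun t : ℝ => x + t • v) (𝓝[≠] 0) (𝓝 x) := by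
          have : Continuous fun t : ℝ => x + t • v := by fun_prop
          simpa using (this.tendsto 0).mono_left nhdsWithin_le_nhds
        rw [hfd]
        refine Tendsto.congr' (f₁ := fun _ => 0) ?_ (by simp)
        filter_upwards [hcont.eventually hz] with t ht
        rw [ht, image_eq_zero_of_notMem_tsupport hx]
        simp
  refine le_of_tendsto key (Eventually.of_forall fun t => ?_)
  have h := integral_sub_mul_sub_nonpos (μ := μ) hf hfL.continuous hg.continuous hgs hg0 (t • v)
  have e : ∀ x, (t⁻¹ * (f (x + t • v) - f x)) * (t⁻¹ * (g (x + t • v) - g x)) =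
    (t⁻¹ * t⁻¹) * ((f (x + t • v) - f x) * (g (x + t • v) - g x)) := fun x => by ring
  simp only [e]
  rw [integral_const_mul]
  exact mul_nonpos_of_nonneg_of_nonpos (mul_self_nonneg _) h

lemma integral_fderiv_gradient_nonpos {f g : E → ℝ} {C : NNReal} (hf : ConvexOn ℝ univ f)
    (hfL : LipschitzWith C f) (hg : ContDiff ℝ 1 g) (hgs : HasCompactSupport g)
    (hg0 : ∀ x, 0 ≤ g x) (hd : ∀ x ∈ tsupport g, DifferentiableAt ℝ f x) :
    Integrable (fun x => fderiv ℝ g x (gradient f x)) μ ∧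
      ∫ x, fderiv ℝ g x (gradient f x) ∂μ ≤ 0 := by
  set b := stdOrthonormalBasis ℝ E
  have e : ∀ x, fderiv ℝ g x (gradient f x) = ∑ i, fderiv ℝ f x (b i) * fderiv ℝ g x (b i) := by
    intro x
    conv_lhs => rw [← b.sum_repr' (gradient f x), map_sum]
    refine Finset.sum_congr rfl fun i _ => ?_
    have : ⟪b i, gradient f x⟫ = fderiv ℝ f x (b i) := by
      rw [real_inner_comm, ← toDual_gradient, InnerProductSpace.toDual_apply_apply]
    rw [map_smul, smul_eq_mul, this]
  simp only [e]
  have hinteg : ∀ i, Integrable (fun x => fderiv ℝ f x (b i) * fderiv ℝ g x (b i)) μ := by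
    intro i
    have hgi : Integrable (fun x => fderiv ℝ g x (b i)) μ := by
      refine Continuous.integrable_of_hasCompactSupport ?_ (hgs.fderiv_apply ℝ (b i))
      exact (hg.continuous_fderiv one_ne_zero).clm_apply continuous_const
    refine hgi.bdd_mul (c := C * ‖b i‖) (measurable_fderiv_apply_const ℝ f _).aestronglyMeasurable
      (Eventually.of_forall fun x => ?_)
    exact (ContinuousLinearMap.le_opNorm _ _).trans
      (mul_le_mul_of_nonneg_right (norm_fderiv_le_of_lipschitz ℝ hfL) (norm_nonneg _))
  refine ⟨integrable_finsetSum _ fun i _ => hinteg i, ?_⟩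
  rw [integral_finsetSum _ fun i _ => hinteg i]
  exact Finset.sum_nonpos fun i _ =>
    integral_fderiv_mul_fderiv_nonpos hf hfL hg hgs hg0 hd (b i)

end ConvexFirstVariation

section HardyInequality

open Filter Topology

lemma eLpNorm_two_le_of_integral_sq_le {α : Type*} [MeasurableSpace α] {μ : Measure α}
    {u v : α → ℝ} (hu : MemLp u 2 μ) (hv : MemLp v 2 μ) {c : ℝ} (hc : 0 ≤ c)
    (h : ∫ x, u x ^ 2 ∂μ ≤ c ^ 2 * ∫ x, v x ^ 2 ∂μ) :
    eLpNorm u 2 μ ≤ ENNReal.ofReal c * eLpNorm v 2 μ := by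
  rw [hu.eLpNorm_eq_integral_rpow_norm two_ne_zero ofNat_ne_top,
    hv.eLpNorm_eq_integral_rpow_norm two_ne_zero ofNat_ne_top, ← ENNReal.ofReal_mul hc]
  refine ENNReal.ofReal_le_ofReal ?_
  simp only [ENNReal.toReal_ofNat, Real.rpow_ofNat, Real.norm_eq_abs, sq_abs]
  rw [← one_div, ← Real.sqrt_eq_rpow, ← Real.sqrt_eq_rpow]
  refine Real.sqrt_le_iff.2 ⟨by positivity, ?_⟩
  rwa [mul_pow, Real.sq_sqrt (integral_nonneg fun x => sq_nonneg _)]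

lemma hasCompactSupport_mul_and_continuous {X : Type*} [TopologicalSpace X] (U : Set X)
    {w φ : X → ℝ} (hφ : Continuous φ)
    (hφs : HasCompactSupport φ) (hφU : tsupport φ ⊆ U) (hw : ∀ x ∈ U, ContinuousAt w x) :
    Continuous (fun x => w x * φ x) ∧ HasCompactSupport (fun x => w x * φ x) :=
  ⟨continuous_of_tsupport fun x hx =>
    (hw x (hφU (tsupport_mul_subset_right hx))).mul hφ.continuousAt, hφs.mul_left⟩

lemma contDiff_of_forall_mem_tsupport {F G : Type*} [NormedAddCommGroup F] [NormedSpace ℝ F]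
    [NormedAddCommGroup G] [NormedSpace ℝ G] {n : WithTop ℕ∞} {f : F → G}
    (h : ∀ x ∈ tsupport f, ContDiffAt ℝ n f x) : ContDiff ℝ n f := by
  refine contDiff_iff_contDiffAt.2 fun x => ?_
  by_cases hx : x ∈ tsupport f
  · exact h x hx
  · exact contDiffAt_const.congr_of_eventuallyEq (notMem_tsupport_iff_eventuallyEq.1 hx)

variable {E : Type*} [NormedAddCommGroup E] [InnerProductSpace ℝ E] [FiniteDimensional ℝ E]
  {K : Set E}

lemma contDiffAt_infDist_rpow (hne : K.Nonempty) (hcl : IsClosed K) (hconv : Convex ℝ K)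
    {x : E} (hx : x ∉ K) (p : ℝ) : ContDiffAt ℝ 1 (fun y => infDist y K ^ p) x :=
  (contDiffAt_infDist hne hcl hconv hx).rpow_const_of_ne ((hcl.notMem_iff_infDist_pos hne).1 hx).ne'

lemma fderiv_rpow_infDist_mul_sq_gradient (hne : K.Nonempty) (hcl : IsClosed K)
    (hconv : Convex ℝ K) {x : E} (hx : x ∉ K) {φ : E → ℝ} (hφ : DifferentiableAt ℝ φ x) (p : ℝ) :
    fderiv ℝ (fun y => infDist y K ^ p * φ y ^ 2) x (gradient (fun y => infDist y K) x) =
      p * infDist x K ^ (p - 1) * φ x ^ 2 +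
        infDist x K ^ p * (2 * φ x * fderiv ℝ φ x (gradient (fun y => infDist y K) x)) := by
  have hpos := (hcl.notMem_iff_infDist_pos hne).1 hx
  have hD := ((contDiffAt_infDist hne hcl hconv hx).differentiableAt one_ne_zero).hasFDerivAt
  have h1 : HasFDerivAt (fun y => infDist y K ^ p * φ y ^ 2) _ x :=
    (hD.rpow_const (p := p) (Or.inl hpos.ne')).mul (hφ.hasFDerivAt.pow 2)
  have hn : fderiv ℝ (fun y => infDist y K) x (gradient (fun y => infDist y K) x) = 1 := by
    rw [← toDual_gradient, InnerProductSpace.toDual_apply_apply, real_inner_self_eq_norm_sq,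
      norm_gradient_infDist hne hcl hconv hx, one_pow]
  rw [h1.fderiv]
  simp only [_root_.add_apply, _root_.smul_apply, smul_eq_mul, hn, nsmul_eq_mul]
  push_cast
  ring

variable [MeasurableSpace E] [BorelSpace E] (μ : Measure E) [μ.IsAddHaarMeasure]

/-- The weighted Hardy inequality in the exterior of a convex set. -/
lemma eLpNorm_infDist_rpow_mul_le (hne : K.Nonempty) (hcl : IsClosed K) (hconv : Convex ℝ K)
    {δ : ℝ} (hδ : 1 < δ) {φ : E → ℝ} (hφ : ContDiff ℝ 1 φ) (hφs : HasCompactSupport φ)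
    (hφK : tsupport φ ⊆ Kᶜ) :
    eLpNorm (fun x => infDist x K ^ (δ / 2 - 1) * φ x) 2 μ ≤
      ENNReal.ofReal (2 / (δ - 1)) *
        eLpNorm (fun x => infDist x K ^ (δ / 2) * ‖fderiv ℝ φ x‖) 2 μ := by
  have hδ0 : 0 < δ - 1 := by linarith
  have hcont : ∀ p : ℝ, ∀ x ∈ Kᶜ, ContinuousAt (fun y => infDist y K ^ p) x := fun p x hx =>
    (contDiffAt_infDist_rpow hne hcl hconv hx p).continuousAt
  obtain ⟨huc, hus⟩ := hasCompactSupport_mul_and_continuous Kᶜ hφ.continuous hφs hφK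
    (hcont (δ / 2 - 1))
  obtain ⟨hvc, hvs⟩ := hasCompactSupport_mul_and_continuous Kᶜ
    (φ := fun x => ‖fderiv ℝ φ x‖) (hφ.continuous_fderiv one_ne_zero).norm (hφs.fderiv ℝ).norm
    ((closure_mono fun x hx => by simpa using hx).trans ((tsupport_fderiv_subset ℝ).trans hφK))
    (hcont (δ / 2))
  set u := fun x => infDist x K ^ (δ / 2 - 1) * φ x with hu
  set v := fun x => infDist x K ^ (δ / 2) * ‖fderiv ℝ φ x‖ with hv
  refine eLpNorm_two_le_of_integral_sq_le (huc.memLp_of_hasCompactSupport hus)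
    (hvc.memLp_of_hasCompactSupport hvs) (by positivity) ?_
  set g := fun x => infDist x K ^ (δ - 1) * φ x ^ 2 with hg
  have hgsub : tsupport g ⊆ tsupport φ :=
    (tsupport_mul_subset_right).trans (closure_mono fun x hx hx' => hx (by simp [hx']))
  have hgc : ContDiff ℝ 1 g := contDiff_of_forall_mem_tsupport fun x hx =>
    (contDiffAt_infDist_rpow hne hcl hconv (hφK (hgsub hx)) _).mul (hφ.contDiffAt.pow 2)
  have hgs : HasCompactSupport g := hφs.mono' (subset_closure.trans hgsub)
  obtain ⟨hinteg, hle⟩ := integral_fderiv_gradient_nonpos (μ := μ)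
    (convexOn_infDist hne hcl hconv) (lipschitz_infDist_pt K) hgc hgs
    (fun x => mul_nonneg (Real.rpow_nonneg infDist_nonneg _) (sq_nonneg _))
    (fun x hx => (contDiffAt_infDist hne hcl hconv (hφK (hgsub hx))).differentiableAt one_ne_zero)
  have iu : Integrable (fun x => u x ^ 2) μ :=
    (huc.pow 2).integrable_of_hasCompactSupport (by simpa only [sq] using hus.mul_left)
  have iv : Integrable (fun x => v x ^ 2) μ :=
    (hvc.pow 2).integrable_of_hasCompactSupport (by simpa only [sq] using hvs.mul_left)
  have hpt : ∀ x, (δ - 1) / 2 * u x ^ 2 - 2 / (δ - 1) * v x ^ 2 ≤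
      fderiv ℝ g x (gradient (fun y => infDist y K) x) := by
    intro x
    by_cases hx : x ∈ tsupport φ
    · have hxK := hφK hx
      have hpos := (hcl.notMem_iff_infDist_pos hne).1 hxK
      rw [hg, fderiv_rpow_infDist_mul_sq_gradient hne hcl hconv hxK
        (hφ.differentiable one_ne_zero x)]
      have hn := norm_gradient_infDist hne hcl hconv hxK
      set n := gradient (fun y => infDist y K) x
      set t := infDist x K
      have e1 : t ^ (δ - 1 - 1) = (t ^ (δ / 2 - 1)) ^ 2 := by
        rw [← Real.rpow_natCast, ← Real.rpow_mul hpos.le]; congr 1; push_cast; ring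
      have e2 : t ^ (δ - 1) = t ^ (δ / 2 - 1) * t ^ (δ / 2) := by
        rw [← Real.rpow_add hpos]; congr 1; ring
      have h1 : |fderiv ℝ φ x n| ≤ ‖fderiv ℝ φ x‖ := by
        simpa [hn] using (fderiv ℝ φ x).le_opNorm n
      have h2 : |u x * (t ^ (δ / 2) * fderiv ℝ φ x n)| ≤ |u x| * v x := by
        rw [abs_mul (u x), abs_mul (t ^ (δ / 2)), abs_of_pos (Real.rpow_pos_of_pos hpos _)]
        exact mul_le_mul_of_nonneg_left (mul_le_mul_of_nonneg_left h1
          (Real.rpow_pos_of_pos hpos _).le) (abs_nonneg _)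
      have h3 := (abs_le.1 h2).1
      have h4 : 0 ≤ ((δ - 1) * |u x| - 2 * v x) ^ 2 / (2 * (δ - 1)) := by positivity
      have h5 : ((δ - 1) * |u x| - 2 * v x) ^ 2 / (2 * (δ - 1)) =
          (δ - 1) / 2 * u x ^ 2 - 2 * (|u x| * v x) + 2 / (δ - 1) * v x ^ 2 := by
        rw [← sq_abs (u x)]
        field_simp
        ring
      have h6 : (δ - 1) * t ^ (δ - 1 - 1) * φ x ^ 2 = (δ - 1) * u x ^ 2 := by
        rw [e1, hu]; ring
      have h7 : t ^ (δ - 1) * (2 * φ x * fderiv ℝ φ x n) =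
          2 * (u x * (t ^ (δ / 2) * fderiv ℝ φ x n)) := by
        rw [e2, hu]; ring
      rw [h6, h7]
      linarith
    · have h1 : u x = 0 := by simp [hu, image_eq_zero_of_notMem_tsupport hx]
      have h2 : fderiv ℝ g x = 0 := fderiv_of_notMem_tsupport ℝ fun h => hx (hgsub h)
      have h3 : v x = 0 := by simp [hv, fderiv_of_notMem_tsupport ℝ hx]
      simp [h1, h2, h3]
  have h := (integral_mono ((iu.const_mul _).sub (iv.const_mul _)) hinteg hpt).trans hle
  simp only [Pi.sub_apply] at h
  rw [integral_sub (iu.const_mul _) (iv.const_mul _), integral_const_mul, integral_const_mul,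
    sub_nonpos] at h
  calc ∫ x, u x ^ 2 ∂μ = 2 / (δ - 1) * ((δ - 1) / 2 * ∫ x, u x ^ 2 ∂μ) := by field_simp
    _ ≤ 2 / (δ - 1) * (2 / (δ - 1) * ∫ x, v x ^ 2 ∂μ) := by gcongr
    _ = _ := by ring

end HardyInequality

section CollarMeasure

open Filter Topology Module

variable {E : Type*} [NormedAddCommGroup E] [InnerProductSpace ℝ E] {K : Set E}

lemma homothety_homothety_inv (c x : E) {l : ℝ} (hl : l ≠ 0) :
    AffineMap.homothety c l (AffineMap.homothety c l⁻¹ x) = x := by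
  rw [AffineMap.homothety_apply, AffineMap.homothety_apply, vsub_eq_sub, vsub_eq_sub, vadd_eq_add,
    vadd_eq_add, add_sub_cancel_right, smul_smul, mul_inv_cancel₀ hl, one_smul, sub_add_cancel]

lemma homothety_mem_of_norm_sub_le (hconv : Convex ℝ K) {c x k : E} {ρ t : ℝ} (hρ : 0 < ρ)
    (ht : 0 < t) (hball : closedBall c ρ ⊆ K) (hk : k ∈ K) (hxk : ‖x - k‖ ≤ t) :
    AffineMap.homothety c (1 + t / ρ)⁻¹ x ∈ K := by
  have hl : 0 < 1 + t / ρ := by positivity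
  have hm : c + (ρ / t) • (x - k) ∈ K := by
    refine hball ?_
    rw [mem_closedBall, dist_eq_norm, add_sub_cancel_left, norm_smul, Real.norm_of_nonneg
      (by positivity)]
    calc ρ / t * ‖x - k‖ ≤ ρ / t * t := by gcongr
      _ = ρ := by field_simp
  have h := hconv hk hm (a := (1 + t / ρ)⁻¹) (b := 1 - (1 + t / ρ)⁻¹) (by positivity)
    (sub_nonneg.2 (inv_le_one_of_one_le₀ (by linarith [div_pos ht hρ]))) (by ring)
  convert h using 1
  have e : (1 - (1 + t / ρ)⁻¹) * (ρ / t) = (1 + t / ρ)⁻¹ := by field_simp; ring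
  rw [AffineMap.homothety_apply, smul_add, smul_smul, e, vsub_eq_sub, vadd_eq_add]
  module

lemma subset_image_homothety {s : Set E} (hs : Convex ℝ s) {c : E} (hc : c ∈ s) {l : ℝ}
    (hl : 1 ≤ l) : s ⊆ AffineMap.homothety c l '' s := by
  intro x hx
  have hl0 : 0 < l := by linarith
  refine ⟨AffineMap.homothety c l⁻¹ x, ?_, ?_⟩
  · have h := hs hx hc (a := l⁻¹) (b := 1 - l⁻¹) (by positivity)
      (sub_nonneg.2 (inv_le_one_of_one_le₀ hl)) (by ring)
    convert h using 1
    rw [AffineMap.homothety_apply, vsub_eq_sub, vadd_eq_add]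
    module
  · exact homothety_homothety_inv c x hl0.ne'

variable [FiniteDimensional ℝ E] [MeasurableSpace E] [BorelSpace E] {μ : Measure E}
  [μ.IsAddHaarMeasure]

/-- The volume of an outer collar of a convex body grows at most linearly in its width. -/
lemma exists_measure_collar_le (hne : K.Nonempty) (hcl : IsClosed K) (hconv : Convex ℝ K)
    {c : E} {ρ : ℝ} (hρ : 0 < ρ) (hball : closedBall c ρ ⊆ K) (R : ℝ) :
    ∃ C : ℝ, 0 < C ∧ ∀ t : ℝ, 0 < t → t ≤ 1 →
      μ ({x | x ∉ K ∧ infDist x K ≤ t} ∩ closedBall c R) ≤ ENNReal.ofReal (C * t) := by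
  set S := K ∩ closedBall c R with hS
  have hSfin : μ S < ∞ := (measure_mono inter_subset_right).trans_lt
    (isCompact_closedBall c R).measure_lt_top
  set n := finrank ℝ E
  refine ⟨(1 + 1 / ρ) ^ n * (μ S).toReal + 1, by positivity, fun t ht ht1 => ?_⟩
  set A := {x | x ∉ K ∧ infDist x K ≤ t} ∩ closedBall c R with hA
  rcases lt_or_ge R 0 with hR | hR
  · simp [hA, closedBall_eq_empty.2 hR]
  have hcK : c ∈ K := hball (mem_closedBall_self hρ.le)
  have hl1 : 1 ≤ 1 + t / ρ := by linarith [div_pos ht hρ]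
  have hl0 : 0 < 1 + t / ρ := by linarith
  have hsub : A ∪ S ⊆ AffineMap.homothety c (1 + t / ρ) '' S := by
    refine union_subset ?_ (subset_image_homothety (hconv.inter (convex_closedBall c R))
      ⟨hcK, mem_closedBall_self hR⟩ hl1)
    rintro x ⟨⟨hxK, hxt⟩, hxR⟩
    refine ⟨AffineMap.homothety c (1 + t / ρ)⁻¹ x, ⟨?_, ?_⟩, ?_⟩
    · refine homothety_mem_of_norm_sub_le hconv hρ ht hball (nearestPt_mem hne hcl hconv x) ?_
      rwa [← infDist_eq_norm_sub_nearestPt]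
    · rw [mem_closedBall, dist_eq_norm] at hxR ⊢
      rw [AffineMap.homothety_apply, vsub_eq_sub, vadd_eq_add, add_sub_cancel_right, norm_smul,
        norm_inv, Real.norm_of_nonneg hl0.le]
      exact (mul_le_of_le_one_left (norm_nonneg _) (inv_le_one_of_one_le₀ hl1)).trans hxR
    · exact homothety_homothety_inv c x hl0.ne'
  have hdisj : Disjoint A S := Set.disjoint_left.2 fun x hx hx' => hx.1.1 hx'.1
  have h1 : μ A + μ S ≤ ENNReal.ofReal ((1 + t / ρ) ^ n) * μ S := by
    rw [← measure_union hdisj (hcl.measurableSet.inter measurableSet_closedBall)]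
    refine (measure_mono hsub).trans_eq ?_
    rw [Measure.addHaar_image_homothety, abs_of_pos (by positivity)]
  have h2 : (1 + t / ρ) ^ n ≤ 1 + (1 + 1 / ρ) ^ n * t := by
    have h := (convexOn_pow n).2 (x := 1) (y := 1 + 1 / ρ) (by simp)
      (by simp only [mem_Ici]; positivity) (sub_nonneg.2 ht1) ht.le (by ring)
    simp only [smul_eq_mul] at h
    have e : (1 - t) * 1 + t * (1 + 1 / ρ) = 1 + t / ρ := by ring
    rw [e, one_pow] at h
    linarith
  have h3 : ENNReal.ofReal ((1 + t / ρ) ^ n) * μ S ≤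
      ENNReal.ofReal ((1 + 1 / ρ) ^ n * t) * μ S + μ S := by
    calc _ ≤ ENNReal.ofReal (1 + (1 + 1 / ρ) ^ n * t) * μ S := by gcongr
      _ = _ := by
        rw [ENNReal.ofReal_add zero_le_one (by positivity), ENNReal.ofReal_one]; ring
  have h4 := (ENNReal.add_le_add_iff_right hSfin.ne).1 (h1.trans h3)
  refine h4.trans ?_
  rw [← ENNReal.ofReal_toReal hSfin.ne, ← ENNReal.ofReal_mul (by positivity)]
  refine ENNReal.ofReal_le_ofReal ?_
  rw [ENNReal.toReal_ofReal ENNReal.toReal_nonneg]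
  nlinarith

/-- The volume of an outer collar of a convex body grows at least linearly in its width. -/
lemma exists_le_measure_collar (hcl : IsClosed K) (hconv : Convex ℝ K)
    {c : E} {ρ : ℝ} (hρ : 0 < ρ) (hball : closedBall c ρ ⊆ K) (hK : K ≠ univ) :
    ∃ R C : ℝ, 0 < R ∧ 0 < C ∧ ∀ t : ℝ, 0 < t → t ≤ R →
      ENNReal.ofReal (C * t) ≤ μ ({x | x ∉ K ∧ infDist x K ≤ t} ∩ closedBall c (2 * R)) := by
  obtain ⟨z, hz⟩ := (ne_univ_iff_exists_notMem K).1 hK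
  obtain ⟨σ, hσ, hzσ⟩ := Metric.isOpen_iff.1 hcl.isOpen_compl z hz
  have hcK : c ∈ K := hball (mem_closedBall_self hρ.le)
  have hzc : z ≠ c := fun h => hz (h ▸ hcK)
  have : Nontrivial E := ⟨z, c, hzc⟩
  have hn : finrank ℝ E ≠ 0 := finrank_pos.ne'
  set n := finrank ℝ E
  set R := ‖z - c‖ + σ with hR
  have hR0 : 0 < R := by positivity
  set S := {x | x ∈ K ∧ ∃ s : ℝ, 0 < s ∧ ∃ y ∈ ball z σ, x = c + s • (y - c)} with hS
  have hSR : ∀ x ∈ S, ‖x - c‖ ≤ R := by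
    rintro x ⟨hxK, s, hs, y, hy, rfl⟩
    have hs1 : s ≤ 1 := by
      by_contra! h1
      refine hzσ hy ?_
      have h := hconv hxK hcK (a := s⁻¹) (b := 1 - s⁻¹) (by positivity)
        (sub_nonneg.2 (inv_le_one_of_one_le₀ h1.le)) (by ring)
      convert h using 1
      rw [smul_add, smul_smul, inv_mul_cancel₀ hs.ne']
      module
    have hyc : ‖y - c‖ ≤ R := by
      rw [mem_ball, dist_eq_norm] at hy
      calc ‖y - c‖ = ‖(z - c) + (y - z)‖ := by congr 1; abel
        _ ≤ _ := (norm_add_le _ _).trans (by linarith)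
    rw [add_sub_cancel_left, norm_smul, Real.norm_of_nonneg hs.le]
    exact (mul_le_of_le_one_left (norm_nonneg _) hs1).trans hyc
  have hSfin : μ S < ∞ := by
    refine (measure_mono fun x hx => ?_).trans_lt (isCompact_closedBall c R).measure_lt_top
    rw [mem_closedBall, dist_eq_norm]
    exact hSR x hx
  have hSpos : 0 < μ S := by
    have hq : 0 < ρ / R := by positivity
    refine (measure_ball_pos μ (c + (ρ / R) • (z - c)) (mul_pos hq hσ)).trans_le
      (measure_mono fun x hx => ?_)
    set y := c + (ρ / R)⁻¹ • (x - c) with hy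
    have hxy : x = c + (ρ / R) • (y - c) := by
      rw [hy, add_sub_cancel_left, smul_smul, mul_inv_cancel₀ hq.ne']; module
    have hyz : y ∈ ball z σ := by
      rw [mem_ball, dist_eq_norm, hxy] at hx
      have e : c + (ρ / R) • (y - c) - (c + (ρ / R) • (z - c)) = (ρ / R) • (y - z) := by module
      rw [e, norm_smul, Real.norm_of_nonneg hq.le] at hx
      rw [mem_ball, dist_eq_norm]
      exact lt_of_mul_lt_mul_left hx hq.le
    refine ⟨hball ?_, ρ / R, hq, y, hyz, hxy⟩
    rw [mem_ball, dist_eq_norm] at hyz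
    have hyc : ‖y - c‖ ≤ R := by
      calc ‖y - c‖ = ‖(z - c) + (y - z)‖ := by congr 1; abel
        _ ≤ _ := (norm_add_le _ _).trans (by linarith)
    rw [mem_closedBall, dist_eq_norm, hxy, add_sub_cancel_left, norm_smul,
      Real.norm_of_nonneg hq.le]
    calc ρ / R * ‖y - c‖ ≤ ρ / R * R := by gcongr
      _ = ρ := by field_simp
  refine ⟨R, (μ S).toReal / R, hR0, div_pos (ENNReal.toReal_pos hSpos.ne' hSfin.ne) hR0,
    fun t ht htR => ?_⟩
  set A := {x | x ∉ K ∧ infDist x K ≤ t} ∩ closedBall c (2 * R) with hA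
  set l := 1 + t / R with hl
  have htR1 : t / R ≤ 1 := (div_le_one hR0).2 htR
  have htR0 : 0 < t / R := by positivity
  have hl0 : 0 < l := by positivity
  have hsub : AffineMap.homothety c l '' S ⊆ S ∪ A := by
    rintro _ ⟨x, hx, rfl⟩
    have hxR := hSR x hx
    obtain ⟨hxK, s, hs, y, hy, hxy⟩ := hx
    rw [AffineMap.homothety_apply, vsub_eq_sub, vadd_eq_add]
    by_cases hK' : l • (x - c) + c ∈ K
    · refine Or.inl ⟨hK', l * s, by positivity, y, hy, ?_⟩
      rw [hxy]; module
    · refine Or.inr ⟨⟨hK', (infDist_le_dist_of_mem hxK).trans ?_⟩, ?_⟩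
      · have e : l • (x - c) + c - x = (t / R) • (x - c) := by rw [hl]; module
        rw [dist_eq_norm, e, norm_smul, Real.norm_of_nonneg htR0.le]
        calc t / R * ‖x - c‖ ≤ t / R * R := by gcongr
          _ = t := by field_simp
      · rw [mem_closedBall, dist_eq_norm, add_sub_cancel_right, norm_smul,
          Real.norm_of_nonneg hl0.le]
        exact mul_le_mul (by linarith) hxR (norm_nonneg _) (by norm_num)
  have h1 : ENNReal.ofReal (l ^ n) * μ S ≤ μ S + μ A := by
    refine le_trans ?_ ((measure_mono hsub).trans (measure_union_le _ _))
    rw [Measure.addHaar_image_homothety, abs_of_pos (by positivity)]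
  have h2 : μ S + ENNReal.ofReal (t / R) * μ S ≤ ENNReal.ofReal (l ^ n) * μ S := by
    calc μ S + ENNReal.ofReal (t / R) * μ S = ENNReal.ofReal l * μ S := by
          rw [hl, ENNReal.ofReal_add zero_le_one htR0.le, ENNReal.ofReal_one]; ring
      _ ≤ _ := by
        gcongr
        exact le_self_pow₀ (by linarith) hn
  have h3 := (ENNReal.add_le_add_iff_left hSfin.ne).1 (h2.trans h1)
  refine le_trans ?_ h3
  rw [← ENNReal.ofReal_toReal hSfin.ne, ← ENNReal.ofReal_mul (by positivity),
    ENNReal.toReal_ofReal ENNReal.toReal_nonneg]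
  exact ENNReal.ofReal_le_ofReal (le_of_eq (by ring))

end CollarMeasure

section ReciprocalIntegral

open Filter Topology

variable {X : Type*} [MeasurableSpace X] {ν : Measure X} {D : X → ℝ}

/-- If sublevel sets of `D` have at most linear measure, then the integral of `1 / D` over
`{exp (-m) ≤ D}` grows at most linearly in `m`. -/
lemma exists_setLIntegral_inv_le [IsFiniteMeasure ν] (hD : Measurable D) {C : ℝ} (hC : 0 < C)
    (h : ∀ t : ℝ, 0 < t → t ≤ 1 → ν {x | 0 < D x ∧ D x ≤ t} ≤ ENNReal.ofReal (C * t)) :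
    ∃ C' : ℝ, 0 < C' ∧ ∀ m : ℕ, ∫⁻ x in {x | Real.exp (-m) ≤ D x}, ENNReal.ofReal (D x)⁻¹ ∂ν ≤
      ENNReal.ofReal (C' * (1 + m)) := by
  have bound : ∀ (s : Set X) (r : ℝ), 0 < r → MeasurableSet s → (∀ x ∈ s, r ≤ D x) →
      ∫⁻ x in s, ENNReal.ofReal (D x)⁻¹ ∂ν ≤ ENNReal.ofReal r⁻¹ * ν s := by
    intro s r hr hs hrs
    rw [← setLIntegral_const]
    exact setLIntegral_mono' hs fun x hx => ENNReal.ofReal_le_ofReal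
      (inv_anti₀ hr (hrs x hx))
  refine ⟨(ν univ).toReal + Real.exp 1 * C, by positivity, fun m => ?_⟩
  induction m with
  | zero =>
    refine (bound _ 1 one_pos (measurableSet_le measurable_const hD) fun x hx => ?_).trans ?_
    · simpa using hx
    · rw [inv_one, ofReal_one, one_mul]
      refine (measure_mono (subset_univ _)).trans ?_
      rw [ENNReal.le_ofReal_iff_toReal_le (measure_ne_top _ _) (by positivity)]
      simp only [Nat.cast_zero, add_zero, mul_one, le_add_iff_nonneg_right]
      positivity
  | succ m ih =>
    have hsub : {x | Real.exp (-(m + 1 : ℕ)) ≤ D x} ⊆ {x | Real.exp (-m) ≤ D x} ∪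
        {x | Real.exp (-(m + 1 : ℕ)) ≤ D x ∧ D x ≤ Real.exp (-m)} := by
      intro x hx
      rcases le_total (Real.exp (-m)) (D x) with h' | h'
      · exact Or.inl h'
      · exact Or.inr ⟨hx, h'⟩
    refine (lintegral_mono_set hsub).trans ((lintegral_union_le _ _ _).trans ?_)
    have h2 : ∫⁻ x in {x | Real.exp (-(m + 1 : ℕ)) ≤ D x ∧ D x ≤ Real.exp (-m)},
        ENNReal.ofReal (D x)⁻¹ ∂ν ≤ ENNReal.ofReal (Real.exp 1 * C) := by
      refine (bound _ _ (Real.exp_pos _) ((measurableSet_le measurable_const hD).inter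
        (measurableSet_le hD measurable_const)) fun x hx => hx.1).trans ?_
      have h3 : ν {x | Real.exp (-(m + 1 : ℕ)) ≤ D x ∧ D x ≤ Real.exp (-m)} ≤
          ENNReal.ofReal (C * Real.exp (-m)) :=
        (measure_mono (t := {x | 0 < D x ∧ D x ≤ Real.exp (-m)}) fun x hx =>
          ⟨(Real.exp_pos _).trans_le hx.1, hx.2⟩).trans
            (h _ (Real.exp_pos _) (Real.exp_le_one_iff.2 (by simp)))
      refine (mul_le_mul_right h3 _).trans ?_
      rw [← ofReal_mul (by positivity), ← Real.exp_neg]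
      refine ofReal_le_ofReal (le_of_eq ?_)
      have : Real.exp (- -((m + 1 : ℕ) : ℝ)) * Real.exp (-m) = Real.exp 1 := by
        rw [← Real.exp_add]; congr 1; push_cast; ring
      rw [← this]; ring
    refine (add_le_add ih h2).trans ?_
    rw [← ofReal_add (by positivity) (by positivity)]
    refine ofReal_le_ofReal ?_
    push_cast
    have : 0 ≤ (ν univ).toReal := toReal_nonneg
    nlinarith

/-- If sublevel sets of `D` have measure comparable to their level, then `1 / D` is not integrable
near `{D = 0}`. -/
lemma setLIntegral_inv_eq_top (hD : Measurable D) {C c R : ℝ} (hc : 0 < c) (hR : 0 < R)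
    (h : ∀ t : ℝ, 0 < t → t ≤ 1 → ν {x | 0 < D x ∧ D x ≤ t} ≤ ENNReal.ofReal (C * t))
    (h' : ∀ t : ℝ, 0 < t → t ≤ R → ENNReal.ofReal (c * t) ≤ ν {x | 0 < D x ∧ D x ≤ t})
    {r : ℝ} (hr : 0 < r) :
    ∫⁻ x in {x | 0 < D x ∧ D x ≤ r}, ENNReal.ofReal (D x)⁻¹ ∂ν = ∞ := by
  by_contra hfin
  have hmeas : ∀ t : ℝ, MeasurableSet {x | 0 < D x ∧ D x ≤ t} := fun t =>
    (measurableSet_lt measurable_const hD).inter (measurableSet_le hD measurable_const)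
  have hpos : ∀ᶠ t in 𝓝[>] (0 : ℝ), 0 < t ∧ t ≤ 1 ∧ t ≤ R ∧ t ≤ r := by
    filter_upwards [self_mem_nhdsWithin, Ioc_mem_nhdsGT one_pos, Ioc_mem_nhdsGT hR,
      Ioc_mem_nhdsGT hr] with t h1 h2 h3 h4 using ⟨h1, h2.2, h3.2, h4.2⟩
  have hlim : Tendsto (fun t : ℝ => ENNReal.ofReal (C * t)) (𝓝[>] 0) (𝓝 0) := by
    have : Tendsto (fun t : ℝ => ENNReal.ofReal (C * t)) (𝓝 0) (𝓝 (ENNReal.ofReal (C * 0))) :=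
      (ENNReal.continuous_ofReal.comp (continuous_const.mul continuous_id)).tendsto 0
    rw [mul_zero, ofReal_zero] at this
    exact this.mono_left nhdsWithin_le_nhds
  have hzero : Tendsto (fun t : ℝ => (ν.restrict {x | 0 < D x ∧ D x ≤ r})
      {x | 0 < D x ∧ D x ≤ t}) (𝓝[>] 0) (𝓝 0) :=
    tendsto_of_tendsto_of_tendsto_of_le_of_le' tendsto_const_nhds hlim
      (Eventually.of_forall fun _ => zero_le)
      (hpos.mono fun t ht => (Measure.restrict_apply_le _ _).trans (h t ht.1 ht.2.1))
  have hinteg := tendsto_setLIntegral_zero hfin hzero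
  have hlow : ∀ᶠ t in 𝓝[>] (0 : ℝ), ENNReal.ofReal c ≤
      ∫⁻ x in {x | 0 < D x ∧ D x ≤ t}, ENNReal.ofReal (D x)⁻¹
        ∂ν.restrict {x | 0 < D x ∧ D x ≤ r} := by
    filter_upwards [hpos] with t ht
    have hsub : {x | 0 < D x ∧ D x ≤ t} ⊆ {x | 0 < D x ∧ D x ≤ r} :=
      fun x hx => ⟨hx.1, hx.2.trans ht.2.2.2⟩
    rw [Measure.restrict_restrict_of_subset hsub]
    calc ENNReal.ofReal c = ENNReal.ofReal t⁻¹ * ENNReal.ofReal (c * t) := by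
          rw [← ofReal_mul (inv_nonneg.2 ht.1.le)]
          congr 1
          have := ht.1.ne'
          field_simp
      _ ≤ ENNReal.ofReal t⁻¹ * ν {x | 0 < D x ∧ D x ≤ t} := by
          gcongr; exact h' t ht.1 ht.2.2.1
      _ = ∫⁻ x in {x | 0 < D x ∧ D x ≤ t}, ENNReal.ofReal t⁻¹ ∂ν := by rw [setLIntegral_const]
      _ ≤ _ := setLIntegral_mono' (hmeas t) fun x hx =>
          ENNReal.ofReal_le_ofReal (inv_anti₀ hx.1 hx.2)
  have := ge_of_tendsto hinteg hlow
  exact absurd this (not_le.2 (ofReal_pos.2 hc))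

end ReciprocalIntegral

section TestFunctions

open Filter Topology
open scoped Manifold

lemma exists_abs_deriv_smoothTransition_le :
    ∃ M : ℝ, 0 < M ∧ ∀ x, |deriv Real.smoothTransition x| ≤ M := by
  have hc : Continuous (deriv Real.smoothTransition) :=
    (Real.smoothTransition.contDiff (n := 1)).continuous_deriv le_rfl
  have h0 : ∀ x, x ∉ Icc (0 : ℝ) 1 → deriv Real.smoothTransition x = 0 := by
    intro x hx
    rw [mem_Icc, not_and_or, not_le, not_le] at hx
    rcases hx with hx | hx
    · have : Real.smoothTransition =ᶠ[𝓝 x] fun _ => 0 := by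
        filter_upwards [Iio_mem_nhds hx] with y hy
          using Real.smoothTransition.zero_of_nonpos (le_of_lt hy)
      rw [this.deriv_eq, deriv_const]
    · have : Real.smoothTransition =ᶠ[𝓝 x] fun _ => 1 := by
        filter_upwards [Ioi_mem_nhds hx] with y hy
          using Real.smoothTransition.one_of_one_le (le_of_lt hy)
      rw [this.deriv_eq, deriv_const]
  obtain ⟨C, hC⟩ := hc.bounded_above_of_compact_support (HasCompactSupport.intro isCompact_Icc h0)
  exact ⟨max C 1, by positivity, fun x => (hC x).trans (le_max_left _ _)⟩

variable {E : Type*} [NormedAddCommGroup E] [InnerProductSpace ℝ E] [FiniteDimensional ℝ E]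
  {K : Set E}

lemma exists_cutoff_near (K : Set E) (c : E) (R : ℝ) {r : ℝ} (hr : 0 < r) :
    ∃ (ζ : E → ℝ) (M : ℝ), 0 < M ∧ ContDiff ℝ 1 ζ ∧ (∀ x, 0 ≤ ζ x ∧ ζ x ≤ 1) ∧
      (∀ x, ‖fderiv ℝ ζ x‖ ≤ M) ∧ HasCompactSupport ζ ∧
      tsupport ζ ⊆ {x | infDist x K ≤ r / 2} ∩ closedBall c (R + 1) ∧
      ∀ x ∈ closedBall c R, infDist x K ≤ r / 3 → ζ x = 1 := by
  have hd : Continuous fun x => infDist x K := continuous_infDist_pt K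
  have hs : IsClosed ({x | r / 2 ≤ infDist x K} ∪ {x | R + 1 ≤ dist x c}) :=
    (isClosed_le continuous_const hd).union
      (isClosed_le continuous_const (continuous_id.dist continuous_const))
  have ht : IsClosed ({x | infDist x K ≤ r / 3} ∩ closedBall c R) :=
    (isClosed_le hd continuous_const).inter isClosed_closedBall
  have hdisj : Disjoint ({x | r / 2 ≤ infDist x K} ∪ {x | R + 1 ≤ dist x c})
      ({x | infDist x K ≤ r / 3} ∩ closedBall c R) := by
    rw [Set.disjoint_left]
    rintro x (hx | hx) ⟨hx1, hx2⟩
    · have h1 : r / 2 ≤ infDist x K := hx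
      have h2 : infDist x K ≤ r / 3 := hx1
      linarith
    · have h1 : R + 1 ≤ dist x c := hx
      have h2 : dist x c ≤ R := hx2
      linarith
  obtain ⟨ζ, h0, h1, h01⟩ := exists_contMDiffMap_zero_one_of_isClosed 𝓘(ℝ, E) (n := 1) hs ht hdisj
  have hζ : ContDiff ℝ 1 ζ := ζ.contMDiff.contDiff
  have hsub : tsupport ζ ⊆ {x | infDist x K ≤ r / 2} ∩ closedBall c (R + 1) := by
    refine closure_minimal (fun x hx => ?_)
      ((isClosed_le hd continuous_const).inter isClosed_closedBall)
    have hxs : x ∉ {x | r / 2 ≤ infDist x K} ∪ {x | R + 1 ≤ dist x c} := fun h => hx (h0 h)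
    rw [mem_union, not_or] at hxs
    rw [mem_ofPred_eq, mem_ofPred_eq, not_le, not_le] at hxs
    exact ⟨hxs.1.le, hxs.2.le⟩
  have hζs : HasCompactSupport ζ :=
    (isCompact_closedBall c (R + 1)).of_isClosed_subset (isClosed_tsupport _)
      (hsub.trans inter_subset_right)
  obtain ⟨C, hC⟩ := (hζ.continuous_fderiv one_ne_zero).bounded_above_of_compact_support
    (hζs.fderiv ℝ)
  exact ⟨ζ, max C 1, by positivity, hζ, h01, fun x => (hC x).trans (le_max_left _ _), hζs, hsub,
    fun x hx hx' => h1 ⟨hx', hx⟩⟩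

/-- Approximate minimisers of the weighted Hardy quotient near `∂K`. -/
lemma exists_hardy_test_function (hne : K.Nonempty) (hcl : IsClosed K) (hconv : Convex ℝ K)
    (c : E) (R : ℝ) {δ r : ℝ} (hδ : 1 < δ) (hr : 0 < r) :
    ∃ M : ℝ, 0 < M ∧ ∀ n : ℕ, 0 < n → ∃ ψ : E → ℝ, ContDiff ℝ 1 ψ ∧ HasCompactSupport ψ ∧
      tsupport ψ ⊆ {x | x ∉ K ∧ infDist x K < r} ∧
      (∀ x, infDist x K ^ (δ / 2) * ‖fderiv ℝ ψ x‖ ≤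
        (δ - 1) / 2 * (infDist x K ^ (δ / 2 - 1) * ψ x) +
          ({x | Real.exp (-(2 * n : ℕ)) ≤ infDist x K} ∩ closedBall c (R + 1)).indicator
            (fun x => M / n * infDist x K ^ (-1 / 2 : ℝ)) x +
          (closedBall c (R + 1)).indicator (fun _ => M) x) ∧
      ∀ x ∈ closedBall c R, Real.exp (-n) ≤ infDist x K → infDist x K ≤ r / 3 →
        infDist x K ^ (δ / 2 - 1) * ψ x = infDist x K ^ (-1 / 2 : ℝ) := by
  obtain ⟨M₁, hM₁, hst⟩ := exists_abs_deriv_smoothTransition_le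
  obtain ⟨ζ, M₂, hM₂, hζ, hζ01, hζM, hζs, hζsub, hζ1⟩ := exists_cutoff_near K c R hr
  set b := (δ - 1) / 2 with hb
  have hb0 : 0 < b := by rw [hb]; linarith
  refine ⟨M₁ + r ^ (1 / 2 : ℝ) * M₂, by positivity, fun n hn => ?_⟩
  have hn0 : (0 : ℝ) < n := by exact_mod_cast hn
  set Φ : ℝ → ℝ := fun t => Real.smoothTransition (2 + Real.log t / n) with hΦ
  have hΦ0 : ∀ t, 0 < t → t ≤ Real.exp (-(2 * n : ℕ)) → Φ t = 0 := fun t ht h => by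
    refine Real.smoothTransition.zero_of_nonpos ?_
    have := (Real.log_le_iff_le_exp ht).2 h
    push_cast at this
    have h2 : Real.log t / n ≤ -2 := (div_le_iff₀ hn0).2 (by linarith)
    linarith
  have hΦ1 : ∀ t, Real.exp (-n) ≤ t → Φ t = 1 := fun t h => by
    refine Real.smoothTransition.one_of_one_le ?_
    have := (Real.le_log_iff_exp_le ((Real.exp_pos _).trans_le h)).2 h
    have h2 : -1 ≤ Real.log t / n := (le_div_iff₀ hn0).2 (by linarith)
    linarith
  have hΦd : ∀ t, 0 < t → ContDiffAt ℝ 1 Φ t := fun t ht =>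
    (Real.smoothTransition.contDiffAt (n := 1)).comp t
      (contDiffAt_const.add ((Real.contDiffAt_log.2 ht.ne').div_const _))
  set f : ℝ → ℝ := fun t => t ^ (-b) * Φ t with hf
  have hfd : ∀ t, 0 < t → HasDerivAt f (-b * t ^ (-b - 1) * Φ t +
      t ^ (-b) * (deriv Real.smoothTransition (2 + Real.log t / n) * (t⁻¹ / n))) t := by
    intro t ht
    have h1 : HasDerivAt (fun t => 2 + Real.log t / n) (t⁻¹ / n) t :=
      ((Real.hasDerivAt_log ht.ne').div_const _).const_add _
    have h2 : HasDerivAt Φ _ t := HasDerivAt.comp t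
      ((Real.smoothTransition.contDiffAt (n := 1)).differentiableAt one_ne_zero).hasDerivAt h1
    exact (Real.hasDerivAt_rpow_const (Or.inl ht.ne')).mul h2
  have hfc : ∀ t, 0 < t → ContDiffAt ℝ 1 f t := fun t ht =>
    (contDiffAt_id.rpow_const_of_ne ht.ne').mul (hΦd t ht)
  have hf0 : ∀ t, 0 ≤ t → t ≤ Real.exp (-(2 * n : ℕ)) → f t = 0 := by
    intro t ht h
    rcases ht.eq_or_lt with rfl | ht
    · simp [hf, Real.zero_rpow (neg_ne_zero.2 hb0.ne')]
    · simp [hf, hΦ0 t ht h]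
  set ψ : E → ℝ := fun x => f (infDist x K) * ζ x with hψ
  have hψsub : tsupport ψ ⊆ {x | Real.exp (-(2 * n : ℕ)) ≤ infDist x K} ∩ tsupport ζ := by
    refine subset_inter (closure_minimal (fun x hx => ?_)
      (isClosed_le continuous_const (continuous_infDist_pt K))) tsupport_mul_subset_right
    by_contra h
    exact hx (by simp [hψ, hf0 _ infDist_nonneg (not_le.1 h).le])
  have hpos : ∀ x ∈ tsupport ψ, 0 < infDist x K := fun x hx =>
    (Real.exp_pos _).trans_le (hψsub hx).1
  have hnK : ∀ x ∈ tsupport ψ, x ∉ K := fun x hx =>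
    (hcl.notMem_iff_infDist_pos hne).2 (hpos x hx)
  refine ⟨ψ, contDiff_of_forall_mem_tsupport fun x hx => ?_, hζs.mul_left, fun x hx => ?_,
    fun x => ?_, fun x hx h1 h2 => ?_⟩
  · exact ((hfc _ (hpos x hx)).comp x (contDiffAt_infDist hne hcl hconv (hnK x hx))).mul
      hζ.contDiffAt
  · have h : infDist x K ≤ r / 2 := (hζsub (hψsub hx).2).1
    exact ⟨hnK x hx, by linarith⟩
  · by_cases hx : x ∈ tsupport ψ
    · obtain ⟨hx1, hx2⟩ := hψsub hx
      obtain ⟨hx3, hx4⟩ := hζsub hx2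
      rw [indicator_of_mem (show x ∈ _ ∩ closedBall c (R + 1) from ⟨hx1, hx4⟩),
        indicator_of_mem hx4]
      have ht := hpos x hx
      have hD := ((contDiffAt_infDist hne hcl hconv (hnK x hx)).differentiableAt
        one_ne_zero).hasFDerivAt
      have hDn : ‖fderiv ℝ (fun y => infDist y K) x‖ ≤ 1 := by
        simpa using norm_fderiv_le_of_lipschitz ℝ (lipschitz_infDist_pt K) (x₀ := x)
      have hf1 := (hfd _ ht).comp_hasFDerivAt x hD
      have hF : HasFDerivAt ψ _ x := hf1.mul (hζ.differentiable one_ne_zero x).hasFDerivAt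
      rw [hF.fderiv]
      have hΦn : 0 ≤ Φ (infDist x K) ∧ Φ (infDist x K) ≤ 1 :=
        ⟨Real.smoothTransition.nonneg _, Real.smoothTransition.le_one _⟩
      have hS := hst (2 + Real.log (infDist x K) / n)
      have hxr : infDist x K ≤ r / 2 := hx3
      have hψx : ψ x = infDist x K ^ (-b) * Φ (infDist x K) * ζ x := rfl
      have hfx : (f ∘ fun y => infDist y K) x = infDist x K ^ (-b) * Φ (infDist x K) := rfl
      rw [hψx, hfx]
      set t := infDist x K
      set P := Φ t
      set L := fderiv ℝ (fun y => infDist y K) x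
      set s := deriv Real.smoothTransition (2 + Real.log t / n)
      have hz := hζ01 x
      have hZ := hζM x
      have hcoef : |-b * t ^ (-b - 1) * P + t ^ (-b) * (s * (t⁻¹ / n))| ≤
          t ^ (-b - 1) * (b * P + M₁ / n) := by
        have e : t ^ (-b) = t ^ (-b - 1) * t := by
          rw [← Real.rpow_add_one ht.ne']; congr 1; ring
        have e2 : -b * t ^ (-b - 1) * P + t ^ (-b) * (s * (t⁻¹ / n)) =
            t ^ (-b - 1) * (-(b * P) + s / n) := by
          rw [e]; field_simp
        rw [e2, abs_mul, abs_of_pos (Real.rpow_pos_of_pos ht _)]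
        refine mul_le_mul_of_nonneg_left ((abs_add_le _ _).trans ?_)
          (Real.rpow_pos_of_pos ht _).le
        rw [abs_neg, abs_of_nonneg (mul_nonneg hb0.le hΦn.1), abs_div, abs_of_pos hn0]
        gcongr
      have hnorm : ‖(t ^ (-b) * P) • fderiv ℝ ζ x +
          ζ x • (-b * t ^ (-b - 1) * P + t ^ (-b) * (s * (t⁻¹ / n))) • L‖ ≤
          t ^ (-b) * M₂ + (t ^ (-b - 1) * (b * P * ζ x) + t ^ (-b - 1) * (M₁ / n)) := by
        refine (norm_add_le _ _).trans (add_le_add ?_ ?_)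
        · rw [norm_smul, Real.norm_of_nonneg
            (mul_nonneg (Real.rpow_pos_of_pos ht _).le hΦn.1)]
          refine mul_le_mul ?_ hZ (norm_nonneg _) (Real.rpow_pos_of_pos ht _).le
          exact mul_le_of_le_one_right (Real.rpow_pos_of_pos ht _).le hΦn.2
        · rw [norm_smul, norm_smul, Real.norm_of_nonneg hz.1, Real.norm_eq_abs]
          calc ζ x * (|-b * t ^ (-b - 1) * P + t ^ (-b) * (s * (t⁻¹ / n))| * ‖L‖)
              ≤ ζ x * (t ^ (-b - 1) * (b * P + M₁ / n) * 1) := by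
                refine mul_le_mul_of_nonneg_left ?_ hz.1
                exact mul_le_mul hcoef hDn (norm_nonneg _) ((abs_nonneg _).trans hcoef)
            _ = t ^ (-b - 1) * (b * P * ζ x) + ζ x * (t ^ (-b - 1) * (M₁ / n)) := by ring
            _ ≤ _ := by
                refine add_le_add_right (mul_le_of_le_one_left ?_ hz.2) _
                positivity
      have e1 : t ^ (δ / 2) * t ^ (-b) = t ^ (1 / 2 : ℝ) := by
        rw [← Real.rpow_add ht]; congr 1; rw [hb]; ring
      have e2 : t ^ (δ / 2) * t ^ (-b - 1) = t ^ (-1 / 2 : ℝ) := by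
        rw [← Real.rpow_add ht]; congr 1; rw [hb]; ring
      have e3 : t ^ (δ / 2 - 1) * t ^ (-b) = t ^ (-1 / 2 : ℝ) := by
        rw [← Real.rpow_add ht]; congr 1; rw [hb]; ring
      have hA : t ^ (1 / 2 : ℝ) ≤ r ^ (1 / 2 : ℝ) :=
        Real.rpow_le_rpow ht.le (by linarith) (by norm_num)
      have hB : 0 ≤ t ^ (-1 / 2 : ℝ) := (Real.rpow_pos_of_pos ht _).le
      calc t ^ (δ / 2) * _ ≤ t ^ (δ / 2) * (t ^ (-b) * M₂ +
            (t ^ (-b - 1) * (b * P * ζ x) + t ^ (-b - 1) * (M₁ / n))) :=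
            mul_le_mul_of_nonneg_left hnorm (Real.rpow_pos_of_pos ht _).le
        _ = (t ^ (δ / 2) * t ^ (-b)) * M₂ + (t ^ (δ / 2) * t ^ (-b - 1)) * (b * P * ζ x) +
            (t ^ (δ / 2) * t ^ (-b - 1)) * (M₁ / n) := by ring
        _ = b * (t ^ (δ / 2 - 1) * t ^ (-b) * P * ζ x) + M₁ / n * t ^ (-1 / 2 : ℝ) +
            t ^ (1 / 2 : ℝ) * M₂ := by rw [e1, e2, e3]; ring
        _ ≤ b * (t ^ (δ / 2 - 1) * t ^ (-b) * P * ζ x) +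
            (M₁ + r ^ (1 / 2 : ℝ) * M₂) / n * t ^ (-1 / 2 : ℝ) +
            (M₁ + r ^ (1 / 2 : ℝ) * M₂) := by
          have hM : M₁ ≤ M₁ + r ^ (1 / 2 : ℝ) * M₂ := le_add_of_nonneg_right (by positivity)
          exact add_le_add (add_le_add le_rfl (by gcongr))
            ((mul_le_mul_of_nonneg_right hA hM₂.le).trans (le_add_of_nonneg_left hM₁.le))
        _ = _ := by ring
    · rw [fderiv_of_notMem_tsupport ℝ hx, image_eq_zero_of_notMem_tsupport hx, norm_zero, mul_zero,
        mul_zero, mul_zero, zero_add]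
      refine add_nonneg (indicator_nonneg (fun x _ => ?_) _)
        (indicator_nonneg (fun x _ => by positivity) _)
      exact mul_nonneg (by positivity) (Real.rpow_nonneg infDist_nonneg _)
  · have ht : 0 < infDist x K := (Real.exp_pos _).trans_le h1
    simp only [hψ, hf, hΦ1 _ h1, hζ1 x hx h2, mul_one]
    rw [← Real.rpow_add ht]
    congr 1
    rw [hb]
    ring

end TestFunctions

section Optimality

open Filter Topology

lemma eLpNorm_two_sq_eq_lintegral {α : Type*} [MeasurableSpace α] {μ : Measure α} (f : α → ℝ) :
    eLpNorm f 2 μ ^ 2 = ∫⁻ x, ENNReal.ofReal (f x ^ 2) ∂μ := by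
  have h := eLpNorm_nnreal_pow_eq_lintegral (f := f) (μ := μ) (p := 2) two_ne_zero
  norm_num at h
  rw [h]
  refine lintegral_congr fun x => ?_
  rw [← enorm_pow, Real.enorm_of_nonneg (sq_nonneg _)]

variable {E : Type*} [NormedAddCommGroup E] [InnerProductSpace ℝ E] [FiniteDimensional ℝ E]
  {K : Set E} [MeasurableSpace E] [BorelSpace E] (μ : Measure E) [μ.IsAddHaarMeasure]

/-- The constant `2 / (δ - 1)` cannot be improved in the weighted Hardy inequality in the exterior
of a convex body, even for test functions supported near the boundary. -/
lemma two_div_le_of_hardy_collar (hcl : IsClosed K) (hconv : Convex ℝ K)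
    {c : E} {ρ : ℝ} (hρ : 0 < ρ) (hball : closedBall c ρ ⊆ K) (hK : K ≠ univ)
    {δ r a : ℝ} (hδ : 1 < δ) (hr : 0 < r) (ha : 0 < a)
    (H : ∀ ψ : E → ℝ, ContDiff ℝ 1 ψ → HasCompactSupport ψ →
      tsupport ψ ⊆ {x | x ∉ K ∧ infDist x K < r} →
      eLpNorm (fun x => infDist x K ^ (δ / 2 - 1) * ψ x) 2 μ ≤
        ENNReal.ofReal a * eLpNorm (fun x => infDist x K ^ (δ / 2) * ‖fderiv ℝ ψ x‖) 2 μ) :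
    2 / (δ - 1) ≤ a := by
  by_contra! hlt
  have hne : K.Nonempty := ⟨c, hball (mem_closedBall_self hρ.le)⟩
  have hδ0 : 0 < δ - 1 := by linarith
  set b := (δ - 1) / 2 with hb
  have hb0 : 0 < b := by positivity
  have hab : 0 < 1 - a * b := by
    rw [lt_div_iff₀ hδ0] at hlt
    rw [hb]; linarith
  have hD : Measurable fun x => infDist x K := (continuous_infDist_pt K).measurable
  obtain ⟨R, C₀, hR, hC₀, hlow⟩ := exists_le_measure_collar (μ := μ) hcl hconv hρ hball hK
  have hset : ∀ t : ℝ, {x | x ∉ K ∧ infDist x K ≤ t} = {x | 0 < infDist x K ∧ infDist x K ≤ t} :=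
    fun t => by ext x; exact and_congr_left fun _ => hcl.notMem_iff_infDist_pos hne
  have hmeas : ∀ t : ℝ, MeasurableSet {x | 0 < infDist x K ∧ infDist x K ≤ t} := fun t =>
    (measurableSet_lt measurable_const hD).inter (measurableSet_le hD measurable_const)
  have hup : ∀ R' : ℝ, ∃ C : ℝ, 0 < C ∧ ∀ t : ℝ, 0 < t → t ≤ 1 →
      μ.restrict (closedBall c R') {x | 0 < infDist x K ∧ infDist x K ≤ t} ≤
        ENNReal.ofReal (C * t) := by
    intro R'
    obtain ⟨C, hC, h⟩ := exists_measure_collar_le (μ := μ) hne hcl hconv hρ hball R'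
    refine ⟨C, hC, fun t ht ht1 => ?_⟩
    rw [Measure.restrict_apply (hmeas t), ← hset]
    exact h t ht ht1
  have hfin : ∀ R' : ℝ, μ (closedBall c R') < ∞ := fun R' =>
    (isCompact_closedBall c R').measure_lt_top
  have := isFiniteMeasure_restrict.2 (hfin (2 * R + 1)).ne
  obtain ⟨C₁, hC₁, hup₁⟩ := hup (2 * R)
  obtain ⟨C₂, hC₂, hup₂⟩ := hup (2 * R + 1)
  have htop := setLIntegral_inv_eq_top (ν := μ.restrict (closedBall c (2 * R))) hD hC₀ hR hup₁
    (fun t ht htR => by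
      rw [Measure.restrict_apply (hmeas t), ← hset]
      exact hlow t ht htR) (show 0 < r / 3 by positivity)
  obtain ⟨C, hC, hlog⟩ := exists_setLIntegral_inv_le hD hC₂ hup₂
  obtain ⟨M, hM, htest⟩ := exists_hardy_test_function hne hcl hconv c (2 * R) hδ hr
  set B := closedBall c (2 * R + 1)
  have hsq : ∀ x, (infDist x K ^ (-1 / 2 : ℝ)) ^ 2 = (infDist x K)⁻¹ := by
    intro x
    rw [← Real.rpow_natCast, ← Real.rpow_mul infDist_nonneg, ← Real.rpow_neg_one]
    norm_num
  have hh₁ : ∀ n : ℕ, 0 < n → eLpNorm (({x | Real.exp (-(2 * n : ℕ)) ≤ infDist x K} ∩ B).indicator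
      fun x => M / n * infDist x K ^ (-1 / 2 : ℝ)) 2 μ ≤ ENNReal.ofReal (M * √(3 * C)) := by
    intro n hn
    have hn1 : (1 : ℝ) ≤ n := by exact_mod_cast hn
    refine (ENNReal.pow_le_pow_left_iff two_ne_zero).1 ?_
    have hms : MeasurableSet {x | Real.exp (-(2 * n : ℕ)) ≤ infDist x K} :=
      measurableSet_le measurable_const hD
    rw [eLpNorm_two_sq_eq_lintegral, ← ofReal_pow (by positivity), mul_pow,
      Real.sq_sqrt (by positivity)]
    calc _ = ∫⁻ x, ({x | Real.exp (-(2 * n : ℕ)) ≤ infDist x K} ∩ B).indicator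
          (fun x => ENNReal.ofReal ((M / n) ^ 2) * ENNReal.ofReal (infDist x K)⁻¹) x ∂μ := by
          refine lintegral_congr fun x => ?_
          by_cases hx : x ∈ {x | Real.exp (-(2 * n : ℕ)) ≤ infDist x K} ∩ B
          · rw [indicator_of_mem hx, indicator_of_mem hx, mul_pow, hsq, ofReal_mul (sq_nonneg _)]
          · rw [indicator_of_notMem hx, indicator_of_notMem hx]
            simp
      _ = ENNReal.ofReal ((M / n) ^ 2) * ∫⁻ x in {x | Real.exp (-(2 * n : ℕ)) ≤ infDist x K},
          ENNReal.ofReal (infDist x K)⁻¹ ∂μ.restrict B := by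
          rw [lintegral_indicator (hms.inter measurableSet_closedBall),
            lintegral_const_mul' _ _ ofReal_ne_top, Measure.restrict_restrict hms]
      _ ≤ ENNReal.ofReal ((M / n) ^ 2) * ENNReal.ofReal (C * (1 + (2 * n : ℕ))) := by
          gcongr
          exact hlog (2 * n)
      _ ≤ _ := by
          rw [← ofReal_mul (sq_nonneg _)]
          refine ofReal_le_ofReal ?_
          rw [div_pow, div_mul_eq_mul_div, div_le_iff₀ (by positivity), mul_assoc]
          refine mul_le_mul_of_nonneg_left ?_ (sq_nonneg _)
          push_cast
          rw [mul_comm 3 C, mul_assoc]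
          exact mul_le_mul_of_nonneg_left (by nlinarith) hC.le
  have hh₂ : eLpNorm (B.indicator fun _ => M) 2 μ ≠ ∞ :=
    (memLp_indicator_const 2 measurableSet_closedBall M (Or.inr (hfin _).ne)).eLpNorm_ne_top
  set Q := a * (M * √(3 * C) + (eLpNorm (B.indicator fun _ => M) 2 μ).toReal) / (1 - a * b) with hQ
  have key : ∀ n : ℕ, ∫⁻ x in {x | Real.exp (-(n + 1 : ℕ)) ≤ infDist x K ∧ infDist x K ≤ r / 3},
      ENNReal.ofReal (infDist x K)⁻¹ ∂μ.restrict (closedBall c (2 * R)) ≤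
        ENNReal.ofReal Q ^ 2 := by
    intro n
    obtain ⟨ψ, hψ, hψs, hψK, hgrad, hval⟩ := htest (n + 1) n.succ_pos
    obtain ⟨huc, hus⟩ := hasCompactSupport_mul_and_continuous Kᶜ hψ.continuous hψs
      (fun x hx => (hψK hx).1) (w := fun x => infDist x K ^ (δ / 2 - 1))
      (fun x hx => (contDiffAt_infDist_rpow hne hcl hconv hx _).continuousAt)
    set u := fun x => infDist x K ^ (δ / 2 - 1) * ψ x with hu
    have hufin : eLpNorm u 2 μ ≠ ∞ := (huc.memLp_of_hasCompactSupport hus).eLpNorm_ne_top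
    have hms : MeasurableSet {x | Real.exp (-(2 * (n + 1) : ℕ)) ≤ infDist x K} :=
      measurableSet_le measurable_const hD
    have hm₁ : Measurable (({x | Real.exp (-(2 * (n + 1) : ℕ)) ≤ infDist x K} ∩ B).indicator
        fun x => M / (n + 1 : ℕ) * infDist x K ^ (-1 / 2 : ℝ)) :=
      ((hD.pow_const _).const_mul _).indicator (hms.inter measurableSet_closedBall)
    have hm₂ : Measurable (B.indicator fun _ => M) :=
      measurable_const.indicator measurableSet_closedBall
    have hu1 : eLpNorm (fun x => infDist x K ^ (δ / 2) * ‖fderiv ℝ ψ x‖) 2 μ ≤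
        ENNReal.ofReal b * eLpNorm u 2 μ + ENNReal.ofReal (M * √(3 * C)) +
          eLpNorm (B.indicator fun _ => M) 2 μ := by
      refine (eLpNorm_mono_real (g := (b • u + ({x | Real.exp (-(2 * (n + 1) : ℕ)) ≤ infDist x K} ∩
        B).indicator fun x => M / (n + 1 : ℕ) * infDist x K ^ (-1 / 2 : ℝ)) +
        B.indicator fun _ => M) fun x => ?_).trans ?_
      · rw [Real.norm_of_nonneg
          (mul_nonneg (Real.rpow_nonneg infDist_nonneg _) (norm_nonneg _))]
        exact hgrad x
      · have hbu : AEStronglyMeasurable (b • u) μ := (huc.const_smul b).aestronglyMeasurable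
        refine (eLpNorm_add_le (hbu.add hm₁.aestronglyMeasurable) hm₂.aestronglyMeasurable
          one_le_two).trans ?_
        gcongr
        refine (eLpNorm_add_le hbu hm₁.aestronglyMeasurable one_le_two).trans ?_
        refine add_le_add ?_ (hh₁ (n + 1) n.succ_pos)
        rw [eLpNorm_const_smul, Real.enorm_of_nonneg hb0.le]
    have hu2 : (eLpNorm u 2 μ).toReal ≤ a * (b * (eLpNorm u 2 μ).toReal + M * √(3 * C) +
        (eLpNorm (B.indicator fun _ => M) 2 μ).toReal) := by
      have h := (H ψ hψ hψs hψK).trans (mul_le_mul_right hu1 _)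
      have h' := toReal_mono (mul_ne_top ofReal_ne_top (add_ne_top.2 ⟨add_ne_top.2
        ⟨mul_ne_top ofReal_ne_top hufin, ofReal_ne_top⟩, hh₂⟩)) h
      rw [toReal_mul, toReal_add (add_ne_top.2 ⟨mul_ne_top ofReal_ne_top hufin, ofReal_ne_top⟩) hh₂,
        toReal_add (mul_ne_top ofReal_ne_top hufin) ofReal_ne_top, toReal_mul,
        toReal_ofReal ha.le, toReal_ofReal hb0.le, toReal_ofReal (by positivity)] at h'
      exact h'
    have hu3 : eLpNorm u 2 μ ≤ ENNReal.ofReal Q := by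
      rw [ENNReal.le_ofReal_iff_toReal_le hufin (by positivity), hQ, le_div_iff₀ hab]
      linarith
    refine le_trans ?_ (pow_le_pow_left₀ zero_le hu3 2)
    have hmT : MeasurableSet {x | Real.exp (-(n + 1 : ℕ)) ≤ infDist x K ∧ infDist x K ≤ r / 3} :=
      (measurableSet_le measurable_const hD).inter (measurableSet_le hD measurable_const)
    rw [eLpNorm_two_sq_eq_lintegral, Measure.restrict_restrict hmT]
    refine le_trans (le_of_eq (setLIntegral_congr_fun (hmT.inter measurableSet_closedBall)
      fun x hx => ?_))
      (setLIntegral_le_lintegral ({x | Real.exp (-(n + 1 : ℕ)) ≤ infDist x K ∧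
        infDist x K ≤ r / 3} ∩ closedBall c (2 * R)) _)
    simp only [hu, hval x hx.2 hx.1.1 hx.1.2, hsq]
  have hcover : {x | 0 < infDist x K ∧ infDist x K ≤ r / 3} ⊆
      ⋃ n : ℕ, {x | Real.exp (-(n + 1 : ℕ)) ≤ infDist x K ∧ infDist x K ≤ r / 3} := by
    intro x hx
    obtain ⟨n, hn⟩ := exists_nat_ge (-Real.log (infDist x K))
    refine mem_iUnion.2 ⟨n, (Real.le_log_iff_exp_le hx.1).1 ?_, hx.2⟩
    push_cast
    linarith
  have hmono : Monotone fun n : ℕ =>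
      {x | Real.exp (-(n + 1 : ℕ)) ≤ infDist x K ∧ infDist x K ≤ r / 3} := by
    intro m n hmn x hx
    refine ⟨le_trans (Real.exp_le_exp.2 ?_) hx.1, hx.2⟩
    push_cast
    have : (m : ℝ) ≤ n := by exact_mod_cast hmn
    linarith
  have hle := (lintegral_mono_set hcover).trans_eq (setLIntegral_iUnion_of_directed
    (μ := μ.restrict (closedBall c (2 * R))) (fun x => ENNReal.ofReal (infDist x K)⁻¹)
    hmono.directed_le)
  rw [htop] at hle
  exact absurd (hle.trans (iSup_le key)) (not_le.2 (pow_lt_top ofReal_lt_top))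

end Optimality

section ExteriorDomain

variable {d : ℕ} {K : Set (EuclideanSpace ℝ (Fin d))}

lemma distB_compl_eq_infDist (hne : K.Nonempty) (hcl : IsClosed K)
    {x : EuclideanSpace ℝ (Fin d)} (hx : x ∉ K) : distB Kᶜ x = infDist x K := by
  have hcne : Kᶜ ≠ univ := by rwa [Ne, compl_univ_iff, ← Ne, ← nonempty_iff_ne_empty]
  obtain ⟨y, hy, hxy⟩ := exists_mem_frontier_infDist_compl_eq_dist (s := Kᶜ) hx hcne
  rw [compl_compl] at hxy
  refine le_antisymm ((infDist_le_dist_of_mem hy).trans_eq hxy.symm) ?_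
  refine infDist_le_infDist_of_subset ?_ ⟨y, hy⟩
  rw [frontier_compl]
  exact hcl.frontier_subset

lemma wNorm_compl_eq (hne : K.Nonempty) (hcl : IsClosed K) (p : ℝ)
    {ψ : EuclideanSpace ℝ (Fin d) → ℝ} (hψ : tsupport ψ ⊆ Kᶜ) :
    wNorm Kᶜ p ψ = eLpNorm (fun x => infDist x K ^ p * ψ x) 2 volume := by
  refine congrArg (fun f => eLpNorm f 2 volume) (funext fun x => ?_)
  by_cases hx : x ∈ tsupport ψ
  · rw [distB_compl_eq_infDist hne hcl (hψ hx)]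
  · rw [image_eq_zero_of_notMem_tsupport hx, mul_zero, mul_zero]

lemma wGradNorm_compl_eq (hne : K.Nonempty) (hcl : IsClosed K) (p : ℝ)
    {ψ : EuclideanSpace ℝ (Fin d) → ℝ} (hψ : tsupport ψ ⊆ Kᶜ) :
    wGradNorm Kᶜ p ψ = eLpNorm (fun x => infDist x K ^ p * ‖fderiv ℝ ψ x‖) 2 volume := by
  refine congrArg (fun f => eLpNorm f 2 volume) (funext fun x => ?_)
  by_cases hx : x ∈ tsupport ψ
  · rw [distB_compl_eq_infDist hne hcl (hψ hx)]
  · rw [fderiv_of_notMem_tsupport ℝ hx, norm_zero, mul_zero, mul_zero]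

lemma bHardy_compl (hne : K.Nonempty) (hcl : IsClosed K) (hconv : Convex ℝ K) {δ : ℝ}
    (hδ : 1 < δ) : BHardy Kᶜ δ Kᶜ (2 / (δ - 1)) := by
  rintro ψ ⟨hψ, hψs, hψK⟩
  rw [wNorm_compl_eq hne hcl _ hψK, wGradNorm_compl_eq hne hcl _ hψK]
  exact eLpNorm_infDist_rpow_mul_le volume hne hcl hconv hδ hψ hψs hψK

lemma BHardy.mono {Ω S T : Set (EuclideanSpace ℝ (Fin d))} {δ a : ℝ} (h : BHardy Ω δ T a)
    (hST : S ⊆ T) : BHardy Ω δ S a :=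
  fun ψ hψ => h ψ ⟨hψ.1, hψ.2.1, hψ.2.2.trans hST⟩

lemma hardyConstS_mono {Ω S T : Set (EuclideanSpace ℝ (Fin d))} {δ : ℝ} (hST : S ⊆ T) :
    hardyConstS Ω δ S ≤ hardyConstS Ω δ T :=
  sInf_le_sInf fun _ ⟨a, ha, hta, h⟩ => ⟨a, ha, hta, h.mono hST⟩

lemma bdryLayer_subset (Ω : Set (EuclideanSpace ℝ (Fin d))) (r : ℝ) : bdryLayer Ω r ⊆ Ω :=
  fun _ hx => hx.1

lemma hardyConstS_compl_le (hne : K.Nonempty) (hcl : IsClosed K) (hconv : Convex ℝ K) {δ : ℝ}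
    (hδ : 1 < δ) : hardyConstS Kᶜ δ Kᶜ ≤ ENNReal.ofReal (2 / (δ - 1)) :=
  sInf_le ⟨_, div_pos two_pos (by linarith), rfl, bHardy_compl hne hcl hconv hδ⟩

lemma le_hardyConstS_bdryLayer_compl (hcl : IsClosed K) (hconv : Convex ℝ K)
    (hinteg : (interior K).Nonempty) (hK : K ≠ univ) {δ r : ℝ} (hδ : 1 < δ) (hr : 0 < r) :
    ENNReal.ofReal (2 / (δ - 1)) ≤ hardyConstS Kᶜ δ (bdryLayer Kᶜ r) := by
  have hne : K.Nonempty := hinteg.mono interior_subset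
  obtain ⟨c, hc⟩ := hinteg
  obtain ⟨ρ, hρ, hball⟩ := nhds_basis_closedBall.mem_iff.1 (mem_interior_iff_mem_nhds.1 hc)
  refine le_sInf ?_
  rintro _ ⟨a, ha, rfl, h⟩
  refine ENNReal.ofReal_le_ofReal
    (two_div_le_of_hardy_collar volume hcl hconv hρ hball hK hδ hr ha fun ψ hψ hψs hψK => ?_)
  have hψK' : tsupport ψ ⊆ Kᶜ := fun x hx => (hψK hx).1
  rw [← wNorm_compl_eq hne hcl _ hψK', ← wGradNorm_compl_eq hne hcl _ hψK']
  refine h ψ ⟨hψ, hψs, fun x hx => ⟨hψK' hx, ?_⟩⟩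
  rw [distB_compl_eq_infDist hne hcl (hψK' hx)]
  exact (hψK hx).2

end ExteriorDomain

/-- Let `K` be a nonempty closed convex subset of `ℝ^d` with nonempty
interior and `K ≠ ℝ^d`, let `Ω = ℝ^d \ K` and `δ > 1`. Then
`(δ-1)‖d_Γ^{δ/2-1}φ‖₂ ≤ 2‖d_Γ^{δ/2}|∇φ|‖₂` for all `φ ∈ C_c^1(Ω)`, and the constant is
optimal: `a_δ(Ω) = a_δ(Γ) = 2/(δ-1)`. -/
theorem stmt17 {d : ℕ} (hd : 1 ≤ d) (K : Set (EuclideanSpace ℝ (Fin d)))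
    (hKne : K.Nonempty) (hKcl : IsClosed K) (hKconv : Convex ℝ K)
    (hKint : (interior K).Nonempty) (hKuniv : K ≠ Set.univ)
    (Ω : Set (EuclideanSpace ℝ (Fin d))) (hΩ : Ω = Kᶜ)
    (δ : ℝ) (hδ : 1 < δ) :
    (∀ φ : EuclideanSpace ℝ (Fin d) → ℝ, IsCc1 Ω φ →
      ENNReal.ofReal (δ - 1) * wNorm Ω (δ/2 - 1) φ ≤ 2 * wGradNorm Ω (δ/2) φ) ∧
    hardyConstS Ω δ Ω = ENNReal.ofReal (2 / (δ - 1)) ∧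
    hardyConst Ω δ = ENNReal.ofReal (2 / (δ - 1)) := by
  subst hΩ
  have hδ0 : 0 < δ - 1 := by linarith
  have hupper := hardyConstS_compl_le hKne hKcl hKconv hδ
  have hlower : ∀ r : ℝ, 0 < r →
      ENNReal.ofReal (2 / (δ - 1)) ≤ hardyConstS Kᶜ δ (bdryLayer Kᶜ r) := fun r hr =>
    le_hardyConstS_bdryLayer_compl hKcl hKconv hKint hKuniv hδ hr
  refine ⟨fun φ hφ => ?_, le_antisymm hupper ?_, le_antisymm ?_ ?_⟩
  · calc ENNReal.ofReal (δ - 1) * wNorm Kᶜ (δ / 2 - 1) φ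
        ≤ ENNReal.ofReal (δ - 1) *
          (ENNReal.ofReal (2 / (δ - 1)) * wGradNorm Kᶜ (δ / 2) φ) :=
          mul_le_mul_right (bHardy_compl hKne hKcl hKconv hδ φ hφ) _
      _ = 2 * wGradNorm Kᶜ (δ / 2) φ := by
          rw [← mul_assoc, ← ENNReal.ofReal_mul hδ0.le, mul_div_cancel₀ _ hδ0.ne',
            ENNReal.ofReal_ofNat]
  · exact (hlower 1 one_pos).trans (hardyConstS_mono (bdryLayer_subset _ _))
  · exact (iInf₂_le 1 one_pos).trans ((hardyConstS_mono (bdryLayer_subset _ _)).trans hupper)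
  · exact le_iInf₂ hlower
end
end

section
/- Let Ω̃ ⊆ ℝ^2 be a domain, m ≥ 1, and Ω = Ω̃ × ℝ^m ⊆ ℝ^{2+m}, so that the distance of (y,z) ∈ Ω to ∂Ω equals the distance of y to ∂Ω̃. Suppose there are b, c > 0 with ‖d_{∂Ω}^{−1}φ‖_2 ≤ b‖∇φ‖_2 + c‖φ‖_2 for all φ ∈ C_c^1(Ω). Then for every nonzero χ ∈ C_c^1(ℝ^m) one has ‖d_{∂Ω̃}^{−1}ψ‖_2 ≤ b‖∇ψ‖_2 + (c + b‖∇χ‖_2/‖χ‖_2)‖ψ‖_2 for all ψ ∈ C_c^1(Ω̃). In particular the weak Hardy constant of Ω̃ is at most that of Ω: b_0(Ω̃) ≤ b_0(Ω). -/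
open MeasureTheory Metric Set ENNReal RealInnerProductSpace

noncomputable section

/-- The projection of `ℝ^{2+m}` onto the first two (Euclidean) coordinates. -/
def proj2 (m : ℕ) (x : EuclideanSpace ℝ (Fin (2 + m))) : EuclideanSpace ℝ (Fin 2) :=
  (EuclideanSpace.equiv (Fin 2) ℝ).symm fun i => x (Fin.castAdd m i)

/-- The isometric splitting `ℝ^{n+m} = ℝ^n × ℝ^m` with the Euclidean product norm. -/
def splitIso (n m : ℕ) : EuclideanSpace ℝ (Fin (n + m)) ≃ₗᵢ[ℝ]
    WithLp 2 (EuclideanSpace ℝ (Fin n) × EuclideanSpace ℝ (Fin m)) :=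
  (LinearIsometryEquiv.piLpCongrLeft 2 ℝ ℝ finSumFinEquiv.symm).trans
    (PiLp.sumPiLpEquivProdLpPiLp 2 _)

/-- The projection of `ℝ^{n+m}` onto the first `n` coordinates. -/
def projL (n m : ℕ) : EuclideanSpace ℝ (Fin (n + m)) →L[ℝ] EuclideanSpace ℝ (Fin n) :=
  (WithLp.fstL 2 ℝ _ _).comp (splitIso n m).toContinuousLinearEquiv.toContinuousLinearMap

/-- The projection of `ℝ^{n+m}` onto the last `m` coordinates. -/
def projR (n m : ℕ) : EuclideanSpace ℝ (Fin (n + m)) →L[ℝ] EuclideanSpace ℝ (Fin m) :=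
  (WithLp.sndL 2 ℝ _ _).comp (splitIso n m).toContinuousLinearEquiv.toContinuousLinearMap

lemma projL_apply (n m : ℕ) (x : EuclideanSpace ℝ (Fin (n + m))) :
    projL n m x = (splitIso n m x).fst := rfl

lemma projR_apply (n m : ℕ) (x : EuclideanSpace ℝ (Fin (n + m))) :
    projR n m x = (splitIso n m x).snd := rfl

lemma projL_eq_proj2 (m : ℕ) (x : EuclideanSpace ℝ (Fin (2 + m))) : projL 2 m x = proj2 m x := by
  ext i
  rfl

lemma norm_projL_le (n m : ℕ) : ‖projL n m‖ ≤ 1 :=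
  ContinuousLinearMap.opNorm_le_bound _ zero_le_one fun x => by
    simpa [projL_apply] using WithLp.norm_fst_le _ (splitIso n m x)

lemma norm_projR_le (n m : ℕ) : ‖projR n m‖ ≤ 1 :=
  ContinuousLinearMap.opNorm_le_bound _ zero_le_one fun x => by
    simpa [projR_apply] using WithLp.norm_snd_le _ (splitIso n m x)

lemma measurePreserving_projL_projR (n m : ℕ) :
    MeasurePreserving (fun x => (projL n m x, projR n m x)) volume (volume.prod volume) :=
  (WithLp.volume_preserving_ofLp _ _).comp (splitIso n m).measurePreserving

lemma exists_projL_eq_projR_eq {n m : ℕ} (y : EuclideanSpace ℝ (Fin n))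
    (z : EuclideanSpace ℝ (Fin m)) : ∃ x, projL n m x = y ∧ projR n m x = z :=
  ⟨(splitIso n m).symm (WithLp.toLp 2 (y, z)), by simp [projL_apply], by simp [projR_apply]⟩

/-- The distance to the boundary of the cylinder `Ω̃ × ℝ^m` is the distance of the base point
to the boundary of `Ω̃`. -/
lemma distB_preimage_projL {n m : ℕ} (S : Set (EuclideanSpace ℝ (Fin n)))
    (x : EuclideanSpace ℝ (Fin (n + m))) :
    distB (projL n m ⁻¹' S) x = distB S (projL n m x) := by
  have hsurj : Function.Surjective (projL n m) := fun y =>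
    (exists_projL_eq_projR_eq y 0).imp fun _ h => h.1
  have hfr : frontier (projL n m ⁻¹' S) = projL n m ⁻¹' frontier S :=
    (((projL n m).isOpenMap hsurj).preimage_frontier_eq_frontier_preimage
      (projL n m).continuous S).symm
  rw [distB, distB, hfr]
  rcases (frontier S).eq_empty_or_nonempty with h | h
  · simp [h]
  apply le_antisymm
  · refine (le_infDist h).2 fun y hy => ?_
    obtain ⟨w, hw, hw'⟩ := exists_projL_eq_projR_eq y (projR n m x)
    refine (infDist_le_dist_of_mem (by simpa [hw] using hy : w ∈ _)).trans_eq ?_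
    rw [← (splitIso n m).dist_map, WithLp.prod_dist_eq_of_L2, ← projL_apply, ← projL_apply,
      ← projR_apply, ← projR_apply, hw, hw']
    simp [Real.sqrt_sq]
  · refine (le_infDist (h.preimage hsurj)).2 fun w hw => ?_
    refine (infDist_le_dist_of_mem (mem_preimage.1 hw)).trans ?_
    rw [← (splitIso n m).dist_map]
    exact WithLp.dist_fst_le _ _

lemma L2N_mul_projL_projR {n m : ℕ} {f : EuclideanSpace ℝ (Fin n) → ℝ}
    {g : EuclideanSpace ℝ (Fin m) → ℝ} (hf : Measurable f) (hg : Measurable g) :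
    L2N (fun x => f (projL n m x) * g (projR n m x)) = L2N f * L2N g := by
  have h := eLpNorm_comp_measurePreserving (p := 2)
    (g := fun w : EuclideanSpace ℝ (Fin n) × EuclideanSpace ℝ (Fin m) => f w.1 * g w.2)
    (by fun_prop) (measurePreserving_projL_projR n m)
  simp only [Function.comp_def] at h
  rw [L2N, L2N, L2N, h]
  simp only [eLpNorm_eq_lintegral_rpow_enorm_toReal two_ne_zero ofNat_ne_top, enorm_mul,
    ENNReal.mul_rpow_of_nonneg _ _ toReal_nonneg]
  rw [lintegral_prod_mul (f := fun y => ‖f y‖ₑ ^ (2 : ℝ≥0∞).toReal)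
    (g := fun z => ‖g z‖ₑ ^ (2 : ℝ≥0∞).toReal) (by fun_prop) (by fun_prop),
    ENNReal.mul_rpow_of_nonneg _ _ (by positivity)]

lemma isCc1_mul_projL_projR {n m : ℕ} {S : Set (EuclideanSpace ℝ (Fin n))}
    {ψ : EuclideanSpace ℝ (Fin n) → ℝ} {χ : EuclideanSpace ℝ (Fin m) → ℝ} (hψ : IsCc1 S ψ)
    (hχ : ContDiff ℝ 1 χ) (hχc : HasCompactSupport χ) :
    IsCc1 (projL n m ⁻¹' S) (fun x => ψ (projL n m x) * χ (projR n m x)) := by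
  obtain ⟨hψ1, hψc, hψS⟩ := hψ
  refine ⟨(hψ1.comp (projL n m).contDiff).mul (hχ.comp (projR n m).contDiff), ?_, ?_⟩
  · let e := (splitIso n m).toHomeomorph.trans
      (WithLp.homeomorphProd 2 (EuclideanSpace ℝ (Fin n)) (EuclideanSpace ℝ (Fin m)))
    refine HasCompactSupport.intro (e.isCompact_preimage.2 (hψc.isCompact.prod hχc.isCompact))
      fun x hx => ?_
    by_contra h0
    exact hx ⟨subset_tsupport _ (left_ne_zero_of_mul h0),
      subset_tsupport _ (right_ne_zero_of_mul h0)⟩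
  · refine (closure_minimal (fun x hx => ?_)
      ((isClosed_tsupport ψ).preimage (projL n m).continuous)).trans (preimage_mono hψS)
    exact subset_tsupport _ (left_ne_zero_of_mul hx)

lemma norm_fderiv_mul_projL_projR_le {n m : ℕ} {ψ : EuclideanSpace ℝ (Fin n) → ℝ}
    {χ : EuclideanSpace ℝ (Fin m) → ℝ} (hψ : Differentiable ℝ ψ) (hχ : Differentiable ℝ χ)
    (x : EuclideanSpace ℝ (Fin (n + m))) :
    ‖fderiv ℝ (fun x => ψ (projL n m x) * χ (projR n m x)) x‖ ≤
      |ψ (projL n m x)| * ‖fderiv ℝ χ (projR n m x)‖ +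
        ‖fderiv ℝ ψ (projL n m x)‖ * |χ (projR n m x)| := by
  have h1 := (hψ (projL n m x)).hasFDerivAt.comp x (projL n m).hasFDerivAt
  have h2 := (hχ (projR n m x)).hasFDerivAt.comp x (projR n m).hasFDerivAt
  have hfd := (h1.mul h2).fderiv
  simp only [Function.comp_def, Pi.mul_def] at hfd
  rw [hfd]
  refine (norm_add_le _ _).trans (add_le_add ?_ ?_)
  · rw [norm_smul, Real.norm_eq_abs]
    gcongr
    exact (ContinuousLinearMap.opNorm_comp_le _ _).trans
      (mul_le_of_le_one_right (norm_nonneg _) (norm_projR_le n m))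
  · rw [norm_smul, Real.norm_eq_abs, mul_comm]
    gcongr
    exact (ContinuousLinearMap.opNorm_comp_le _ _).trans
      (mul_le_of_le_one_right (norm_nonneg _) (norm_projL_le n m))

lemma L2N_fderiv_mul_projL_projR_le {n m : ℕ} {ψ : EuclideanSpace ℝ (Fin n) → ℝ}
    {χ : EuclideanSpace ℝ (Fin m) → ℝ} (hψ : ContDiff ℝ 1 ψ) (hχ : ContDiff ℝ 1 χ) :
    L2N (fun x => ‖fderiv ℝ (fun x => ψ (projL n m x) * χ (projR n m x)) x‖) ≤
      L2N ψ * L2N (fun z => ‖fderiv ℝ χ z‖) + L2N (fun y => ‖fderiv ℝ ψ y‖) * L2N χ := by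
  have hψ' := hψ.continuous_fderiv one_ne_zero
  have hχ' := hχ.continuous_fderiv one_ne_zero
  have hψ0 := hψ.continuous
  have hχ0 := hχ.continuous
  have habs : ∀ {d : ℕ} (f : EuclideanSpace ℝ (Fin d) → ℝ), L2N (fun y => |f y|) = L2N f :=
    fun f => eLpNorm_norm f
  rw [← habs ψ, ← habs χ, ← L2N_mul_projL_projR (by fun_prop) (by fun_prop),
    ← L2N_mul_projL_projR (by fun_prop) (by fun_prop)]
  refine (eLpNorm_mono_real fun x => ?_).trans (eLpNorm_add_le
    (Continuous.aestronglyMeasurable (by fun_prop))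
    (Continuous.aestronglyMeasurable (by fun_prop)) one_le_two)
  rw [norm_norm]
  exact norm_fderiv_mul_projL_projR_le (hψ.differentiable one_ne_zero)
    (hχ.differentiable one_ne_zero) x

/-- The unweighted weak Hardy inequality passes from a cylinder to its base. -/
lemma WHardy.of_preimage_projL {n m : ℕ} {S : Set (EuclideanSpace ℝ (Fin n))} {b c : ℝ}
    (hb : 0 ≤ b) (hc : 0 ≤ c) (hW : WHardy (projL n m ⁻¹' S) 0 (projL n m ⁻¹' S) b c)
    {χ : EuclideanSpace ℝ (Fin m) → ℝ} (hχ : ContDiff ℝ 1 χ) (hχc : HasCompactSupport χ)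
    (hχ0 : χ ≠ 0) :
    WHardy S 0 S b (c + b * ((L2N fun z => ‖fderiv ℝ χ z‖).toReal / (L2N χ).toReal)) := by
  intro ψ hψ
  have hX0 : L2N χ ≠ 0 := by
    rw [L2N, Ne, eLpNorm_eq_zero_iff hχ.continuous.aestronglyMeasurable two_ne_zero]
    exact fun h => hχ0 ((hχ.continuous.ae_eq_iff_eq volume continuous_zero).1 h)
  have hXt : L2N χ ≠ ⊤ := (hχ.continuous.memLp_of_hasCompactSupport hχc).eLpNorm_ne_top
  have hKt : L2N (fun z => ‖fderiv ℝ χ z‖) ≠ ⊤ :=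
    ((hχ.continuous_fderiv one_ne_zero).norm.memLp_of_hasCompactSupport
      (hχc.fderiv (𝕜 := ℝ)).norm).eLpNorm_ne_top
  have hmain := hW _ (isCc1_mul_projL_projR hψ hχ hχc)
  have hL := L2N_fderiv_mul_projL_projR_le hψ.1 hχ
  have hmψ := hψ.1.continuous.measurable
  have hmχ := hχ.continuous.measurable
  have hmd : Measurable (fun y => distB S y ^ ((0 : ℝ) / 2 - 1) * ψ y) :=
    (measurable_infDist.pow_const _).mul hmψ
  simp only [wNorm, wGradNorm, distB_preimage_projL, zero_div, Real.rpow_zero, one_mul,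
    ← mul_assoc] at hmain hmd ⊢
  rw [L2N_mul_projL_projR hmd hmχ, L2N_mul_projL_projR hmψ hmχ] at hmain
  set K := L2N (fun z => ‖fderiv ℝ χ z‖)
  set X := L2N χ
  rw [ENNReal.ofReal_add hc (by positivity), ENNReal.ofReal_mul hb,
    ENNReal.ofReal_div_of_pos (toReal_pos hX0 hXt), ofReal_toReal hKt, ofReal_toReal hXt]
  rw [← ENNReal.mul_le_mul_iff_left hX0 hXt]
  refine hmain.trans ((add_le_add_left (mul_le_mul_right hL _) _).trans_eq ?_)
  have hK : K = K / X * X := (ENNReal.div_mul_cancel hX0 hXt).symm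
  conv_lhs => rw [hK]
  ring

lemma exists_contDiff_hasCompactSupport_ne_zero (m : ℕ) :
    ∃ χ : EuclideanSpace ℝ (Fin m) → ℝ, ContDiff ℝ 1 χ ∧ HasCompactSupport χ ∧ χ ≠ 0 := by
  let f : ContDiffBump (0 : EuclideanSpace ℝ (Fin m)) := ⟨1, 2, one_pos, one_lt_two⟩
  refine ⟨f, f.contDiff, f.hasCompactSupport, fun h => ?_⟩
  have h1 : f 0 = 1 := f.one_of_mem_closedBall (by simp [f])
  simp [h] at h1

/-- Let `Ω̃ ⊆ ℝ²` be a domain, `m ≥ 1` and `Ω = Ω̃ × ℝ^m ⊆ ℝ^{2+m}`.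
If the (unweighted, `δ = 0`) weak Hardy inequality holds on `Ω` with constants
`b, c > 0`, then for every nonzero `χ ∈ C_c^1(ℝ^m)` the weak Hardy inequality holds on
`Ω̃` with constants `b` and `c + b‖∇χ‖₂/‖χ‖₂`; in particular `b₀(Ω̃) ≤ b₀(Ω)`. -/
theorem stmt18 (m : ℕ) (hm : 1 ≤ m)
    (Ωt : Set (EuclideanSpace ℝ (Fin 2))) (hΩt : IsDomainSet Ωt)
    (Ω : Set (EuclideanSpace ℝ (Fin (2 + m))))
    (hΩ : Ω = {x : EuclideanSpace ℝ (Fin (2 + m)) | proj2 m x ∈ Ωt})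
    (b c : ℝ) (hb : 0 < b) (hc : 0 < c)
    (hW : WHardy Ω 0 Ω b c) :
    (∀ χ : EuclideanSpace ℝ (Fin m) → ℝ,
      ContDiff ℝ 1 χ → HasCompactSupport χ → χ ≠ 0 →
      WHardy Ωt 0 Ωt b
        (c + b * ((L2N fun z => ‖fderiv ℝ χ z‖).toReal / (L2N χ).toReal))) ∧
    weakConstDomain Ωt 0 ≤ weakConstDomain Ω 0 := by
  have hΩ' : Ω = projL 2 m ⁻¹' Ωt := by
    rw [hΩ]
    ext x
    simp [projL_eq_proj2]
  subst hΩ'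
  refine ⟨fun χ hχ hχc hχ0 => hW.of_preimage_projL hb.le hc.le hχ hχc hχ0, ?_⟩
  obtain ⟨χ, hχ, hχc, hχ0⟩ := exists_contDiff_hasCompactSupport_ne_zero m
  refine sInf_le_sInf ?_
  rintro _ ⟨b', c', hb', hc', rfl, hW'⟩
  exact ⟨b', _, hb', by positivity, rfl, hW'.of_preimage_projL hb'.le hc'.le hχ hχc hχ0⟩
end
end
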